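/- Let Γ be a discrete subgroup of PSL(2,ℂ) of finite covolume, and suppose Γ is contained in PSL(2,R) where R is a finitely generated subring of a number field k. Let H and K be abelian subgroups of Γ and let g ∈ Γ. Then the double coset HgK is closed in the congruence topology on Γ (with respect to this embedding and R) if one of the following conditions holds: (i) H and K are both loxodromic subgroups of Γ; (ii) exactly one of H, K is a loxodromic subgroup of Γ and the other is a maximal parabolic subgroup of Γ; (iii) exactly one of H, K is a loxodromic subgroup of Γ and the other is a maximal cyclic parabolic subgroup of Γ. The loxodromic subgroups are not required to be maximal. -/

import Mathlib

set_option synthInstance.maxHeartbeats 400000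
set_option maxHeartbeats 800000

open Matrix MeasureTheory

/-- The special linear group `SL(2, ℂ)`, topologized as a subspace of the matrices. -/
abbrev SL2C := Matrix.SpecialLinearGroup (Fin 2) ℂ

noncomputable instance : TopologicalSpace SL2C := instTopologicalSpaceSubtype

/-- `PSL(2, ℂ)`: the quotient of `SL(2, ℂ)` by its center `{±I}`. -/
abbrev PSL2C := SL2C ⧸ Subgroup.center SL2C

noncomputable instance : MeasurableSpace PSL2C := borel _

/-- A subset `X` of a group `G` is separable (closed in the profinite topology) if for
every `γ ∈ G − X` there is a homomorphism `φ` from `G` to a finite group with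
`φ γ ∉ φ '' X`. -/
def IsSeparableSubset {G : Type} [Group G] (X : Set G) : Prop :=
  ∀ γ : G, γ ∉ X → ∃ (F : Type) (_ : Group F) (_ : Finite F) (φ : G →* F), φ γ ∉ φ '' X

/-- A subgroup `Γ ≤ PSL(2, ℂ)` has finite covolume if, with respect to a Haar measure
`μ` on `PSL(2, ℂ)`, the action of `Γ` on `PSL(2, ℂ)` admits a fundamental domain of
finite measure (equivalently, the quotient carries an induced invariant measure of
finite total mass). -/
def HasFiniteCovolume (Γ : Subgroup PSL2C) : Prop :=
  ∃ μ : Measure PSL2C, μ.IsHaarMeasure ∧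
    ∃ s : Set PSL2C, IsFundamentalDomain (↥Γ) s μ ∧ μ s ≠ ⊤

/-- A non-identity element of `PSL(2, ℂ)` is parabolic if its representatives in
`SL(2, ℂ)` have trace `±2`. -/
def IsParabolic (x : PSL2C) : Prop :=
  x ≠ 1 ∧ ∃ A : SL2C, (QuotientGroup.mk A : PSL2C) = x ∧
    (Matrix.trace (A : Matrix (Fin 2) (Fin 2) ℂ) = 2 ∨
     Matrix.trace (A : Matrix (Fin 2) (Fin 2) ℂ) = -2)

/-- An element of `PSL(2, ℂ)` is loxodromic if the square of the trace of a
representative in `SL(2, ℂ)` is not a real number in the interval `[0, 4]`. -/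
def IsLoxodromic (x : PSL2C) : Prop :=
  ∃ A : SL2C, (QuotientGroup.mk A : PSL2C) = x ∧
    ∀ r : ℝ, 0 ≤ r → r ≤ 4 → (Matrix.trace (A : Matrix (Fin 2) (Fin 2) ℂ)) ^ 2 ≠ (r : ℂ)

/-- A maximal parabolic subgroup of `Γ ≤ PSL(2, ℂ)`: a subgroup all of whose
non-identity elements are parabolic, maximal among such subgroups of `Γ`. -/
def IsMaxParabolicSubgroup (Γ : Subgroup PSL2C) (P : Subgroup ↥Γ) : Prop :=
  (∀ x ∈ P, x ≠ 1 → IsParabolic (x : PSL2C)) ∧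
  ∀ P' : Subgroup ↥Γ, (∀ x ∈ P', x ≠ 1 → IsParabolic (x : PSL2C)) → P ≤ P' → P' = P

/-- A maximal cyclic parabolic subgroup of `Γ ≤ PSL(2, ℂ)`: a cyclic subgroup
consisting of parabolic elements (and the identity), maximal among cyclic
subgroups of `Γ`. -/
def IsMaxCyclicParabolicSubgroup (Γ : Subgroup PSL2C) (P : Subgroup ↥Γ) : Prop :=
  (∃ x : ↥Γ, P = Subgroup.zpowers x) ∧
  (∀ x ∈ P, x ≠ 1 → IsParabolic (x : PSL2C)) ∧
  ∀ P' : Subgroup ↥Γ, (∃ y : ↥Γ, P' = Subgroup.zpowers y) → P ≤ P' → P' = P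

/-- A loxodromic subgroup of `Γ ≤ PSL(2, ℂ)`: an infinite cyclic subgroup generated
by a loxodromic element. -/
def IsLoxodromicSubgroup (Γ : Subgroup PSL2C) (H : Subgroup ↥Γ) : Prop :=
  ∃ x : ↥Γ, IsLoxodromic (x : PSL2C) ∧ ¬IsOfFinOrder x ∧ H = Subgroup.zpowers x

/-- `PSL(2, R)` for a commutative ring `R`: `SL(2, R)` modulo its center. -/
abbrev PSL2 (R : Type) [CommRing R] :=
  Matrix.SpecialLinearGroup (Fin 2) R ⧸ Subgroup.center (Matrix.SpecialLinearGroup (Fin 2) R)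

/-- `Γ ≤ PSL(2, ℂ)` is contained in `PSL(2, R)` for a subring `R ≤ ℂ`: every element of
`Γ` is represented by a matrix in `SL(2, R)`. -/
def ContainedInPSL2 (R : Subring ℂ) (Γ : Subgroup PSL2C) : Prop :=
  ∀ x : ↥Γ, ∃ A : Matrix.SpecialLinearGroup (Fin 2) ↥R,
    (QuotientGroup.mk (Matrix.SpecialLinearGroup.map R.subtype A) : PSL2C) = (x : PSL2C)

/-- A subset `X` of `Γ ≤ PSL(2, ℂ)`, with `Γ ⊆ PSL(2, R)`, is closed in the congruence
topology on `Γ` (with respect to `R`) if for every `γ ∈ Γ − X` there is a non-zero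
ideal `I` of `R` such that the image of `γ` under the congruence homomorphism
`Γ → PSL(2, R) → PSL(2, R/I)` does not lie in the image of `X`.  The congruence
homomorphism `η` is characterized by sending any element of `Γ` represented by a
matrix `A ∈ SL(2, R)` to the class of the reduction of `A` modulo `I`. -/
def CongruenceClosed (R : Subring ℂ) (Γ : Subgroup PSL2C) (X : Set ↥Γ) : Prop :=
  ∀ γ : ↥Γ, γ ∉ X → ∃ I : Ideal ↥R, I ≠ ⊥ ∧
    ∃ η : ↥Γ →* PSL2 (↥R ⧸ I),
      (∀ (x : ↥Γ) (A : Matrix.SpecialLinearGroup (Fin 2) ↥R),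
        (QuotientGroup.mk (Matrix.SpecialLinearGroup.map R.subtype A) : PSL2C) = (x : PSL2C) →
        η x = QuotientGroup.mk (Matrix.SpecialLinearGroup.map (Ideal.Quotient.mk I) A)) ∧
      η γ ∉ η '' X

/-- `R` is a finitely generated subring of a number field (a subfield of `ℂ` that is
finite-dimensional over `ℚ`). -/
def IsFGSubringOfNumberField (R : Subring ℂ) : Prop :=
  (∃ s : Finset ℂ, R = Subring.closure ↑s) ∧
  ∃ k : Subfield ℂ, FiniteDimensional ℚ ↥k ∧ R ≤ k.toSubring

/-- If `a` is not a root of unity then, for an absolute value `w`, two exponents at distance at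
most `D` cannot both make `w (a ^ j - 1)` much smaller than `max 1 (w a ^ j)`. -/
lemma AbsoluteValue.exists_pos_mul_max_le_or {K : Type*} [Field K] (w : AbsoluteValue K ℝ) {a : K}
    (ha : ∀ d : ℕ, 0 < d → a ^ d ≠ 1) (D : ℕ) :
    ∃ c : ℝ, 0 < c ∧ ∀ j d : ℕ, 0 < j → 0 < d → d ≤ D →
      c * max 1 (w a ^ j) ≤ w (a ^ j - 1) ∨
        c * max 1 (w a ^ (j + d)) ≤ w (a ^ (j + d) - 1) := by
  have hw0 : 0 ≤ w a := w.nonneg a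
  rcases lt_trichotomy (w a) 1 with h | h | h
  · refine ⟨1 - w a, by linarith, fun j d hj _ _ => Or.inl ?_⟩
    have h1 : w a ^ j ≤ 1 := pow_le_one₀ hw0 h.le
    have h2 : w a ^ j ≤ w a := pow_le_of_le_one hw0 h.le hj.ne'
    have h3 := w.le_sub 1 (a ^ j)
    rw [w.map_sub, map_one, map_pow] at h3
    rw [max_eq_left h1]
    linarith
  · obtain ⟨c, hc, hcd⟩ : ∃ c : ℝ, 0 < c ∧ ∀ d : ℕ, 0 < d → d ≤ D → 2 * c ≤ w (a ^ d - 1) := by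
      induction D with
      | zero => exact ⟨1, one_pos, fun d h1 h2 => by omega⟩
      | succ D ih =>
        obtain ⟨c, hc, hcd⟩ := ih
        have hpos : 0 < w (a ^ (D + 1) - 1) :=
          w.pos (sub_ne_zero.mpr (ha (D + 1) D.succ_pos))
        refine ⟨min c (w (a ^ (D + 1) - 1) / 2), by positivity, fun d h1 h2 => ?_⟩
        rcases Nat.lt_or_eq_of_le h2 with h3 | rfl
        · have := hcd d h1 (by omega)
          have := min_le_left c (w (a ^ (D + 1) - 1) / 2)
          linarith
        · have := min_le_right c (w (a ^ (D + 1) - 1) / 2)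
          linarith
    refine ⟨c, hc, fun j d _ hd hdD => ?_⟩
    by_contra! hcon
    simp only [h, one_pow, max_self, mul_one] at hcon
    have h1 := w.sub_le (a ^ (j + d)) 1 (a ^ j)
    have h2 : a ^ (j + d) - a ^ j = a ^ j * (a ^ d - 1) := by ring
    rw [h2, map_mul, map_pow, h, one_pow, one_mul, w.map_sub 1] at h1
    linarith [hcd d hd hdD]
  · refine ⟨1 - (w a)⁻¹, by linarith [inv_lt_one_of_one_lt₀ h], fun j d hj _ _ => Or.inl ?_⟩
    have h1 : 1 ≤ w a ^ j := one_le_pow₀ h.le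
    have h3 := w.le_sub (a ^ j) 1
    rw [map_one, map_pow] at h3
    rw [max_eq_right h1]
    have h4 : 1 ≤ (w a)⁻¹ * w a ^ j := by
      obtain ⟨i, rfl⟩ := Nat.exists_eq_succ_of_ne_zero hj.ne'
      rw [pow_succ', inv_mul_cancel_left₀ (by positivity)]
      exact one_le_pow₀ h.le
    linarith

/-- If `a` is not a root of unity, there are arbitrarily large `j` for which `a ^ j - 1` is
as large as `max 1 (w a ^ j)` up to a constant, simultaneously for finitely many `w`. -/
lemma AbsoluteValue.exists_pos_forall_mul_max_le {K ι : Type*} [Field K] [Finite ι]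
    (w : ι → AbsoluteValue K ℝ) {a : K} (ha : ∀ d : ℕ, 0 < d → a ^ d ≠ 1) :
    ∃ c : ℝ, 0 < c ∧ ∀ J : ℕ, ∃ j > J, ∀ i, c * max 1 (w i a ^ j) ≤ w i (a ^ j - 1) := by
  have := Fintype.ofFinite ι
  choose c hc hcd using fun i => (w i).exists_pos_mul_max_le_or ha (Fintype.card ι)
  obtain ⟨c', hc', hcc'⟩ : ∃ c' : ℝ, 0 < c' ∧ ∀ i, c' ≤ c i := by
    rcases isEmpty_or_nonempty ι with h | h
    · exact ⟨1, one_pos, fun i => h.elim i⟩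
    · obtain ⟨i, hi⟩ := Finite.exists_min c
      exact ⟨c i, hc i, hi⟩
  refine ⟨c', hc', fun J => ?_⟩
  by_contra! hcon
  have : Nonempty ι := ⟨(hcon (J + 1) J.lt_succ_self).choose⟩
  choose! f hf using hcon
  have hbad : ∀ j > J, w (f j) (a ^ j - 1) < c (f j) * max 1 (w (f j) a ^ j) := fun j hj =>
    (hf j hj).trans_le (by gcongr; exact hcc' _)
  obtain ⟨s, t, hst, hfst⟩ := Fintype.exists_ne_map_eq_of_card_lt
    (fun s : Fin (Fintype.card ι + 1) => f (J + 1 + s)) (by simp)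
  wlog hlt : s < t generalizing s t
  · exact this t s hst.symm hfst.symm (lt_of_le_of_ne (not_lt.mp hlt) hst.symm)
  have hlt' : (s : ℕ) < t := hlt
  have hs := hbad (J + 1 + s) (by omega)
  have ht := hbad (J + 1 + t) (by omega)
  rw [← hfst] at ht
  rcases hcd (f (J + 1 + s)) (J + 1 + s) (t - s) (by omega) (by omega) (by omega) with h | h
  · exact absurd h (not_le.mpr hs)
  · rw [show J + 1 + (s : ℕ) + (t - s) = J + 1 + t by omega] at h
    exact absurd h (not_le.mpr ht)

open NumberField in
/-- Elements of a number field that are uniformly bounded at the infinite places and at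
finitely many finite places, and integral elsewhere, form a finite set. -/
lemma NumberField.finite_setOf_places_le {K : Type*} [Field K] [NumberField K]
    {W : Set (FinitePlace K)} (hW : W.Finite) (B : ℝ) :
    {y : K | (∀ v : InfinitePlace K, v y ≤ B) ∧ (∀ v ∈ W, v y ≤ B) ∧
      ∀ v : FinitePlace K, v ∉ W → v y ≤ 1}.Finite := by
  classical
  refine (Northcott.finite_le (h := Height.mulHeight₁ (K := K))
    ((∏ v : InfinitePlace K, max B 1 ^ v.mult) * ∏ v ∈ hW.toFinset, max B 1)).subset ?_
  rintro y ⟨h1, h2, h3⟩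
  rw [Set.mem_ofPred_eq, NumberField.mulHeight₁_eq]
  have hsupp : (Function.mulSupport fun v : FinitePlace K => max (v y) 1) ⊆ hW.toFinset := by
    intro v hv
    by_contra hvW
    exact hv (max_eq_right (h3 v (by simpa using hvW)))
  rw [finprod_eq_prod_of_mulSupport_subset _ hsupp]
  gcongr with v _ v hv
  · exact h1 v
  · exact h2 v (by simpa using hv)

/-- Reduction of exponents: in a commutative ring, if `u ^ j = 1` then every integral power of `u`
is a power with exponent `< j`. -/
lemma exists_lt_zpow_eq_pow {G : Type*} [Group G] {u : G} {j : ℕ} (hj : 0 < j) (hu : u ^ j = 1)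
    (m : ℤ) : ∃ i < j, u ^ m = u ^ i := by
  have hj' : (j : ℤ) ≠ 0 := by exact_mod_cast hj.ne'
  have h0 := Int.emod_nonneg m hj'
  have h1 := Int.emod_lt_of_pos m (b := j) (by exact_mod_cast hj)
  refine ⟨(m % j).toNat, by omega, ?_⟩
  rw [← zpow_natCast, Int.toNat_of_nonneg h0]
  conv_lhs => rw [← Int.emod_add_mul_ediv m j, _root_.zpow_add, _root_.zpow_mul, zpow_natCast, hu, _root_.one_zpow,
    mul_one]

/-- A point `x` such that `x - a ^ i` is infinitely often divisible by `a ^ j - 1`, with quotient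
from a finite set and `i < j`, is a power of `a`. -/
lemma exists_zpow_eq_of_finite_quotients {K : Type*} [Field K] (φ : K →+* ℂ) {a x : K}
    (ha : 1 < ‖φ a‖) {Y : Set K} (hY : Y.Finite)
    (h : ∀ J : ℕ, ∃ j > J, ∃ i < j, ∃ y ∈ Y, x - a ^ i = y * (a ^ j - 1)) :
    ∃ m : ℤ, x = a ^ m := by
  have ha0 : a ≠ 0 := by
    rintro rfl
    norm_num at ha
  by_contra! hx
  choose j hj i hi y hy hxy using h
  -- a single quotient `z` occurs infinitely often
  obtain ⟨z, hz, hinf⟩ : ∃ z ∈ Y, (y ⁻¹' {z}).Infinite := by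
    by_contra! hfin
    refine Set.infinite_univ (α := ℕ) ((hY.biUnion fun z hz => hfin z hz).subset fun n _ => ?_)
    exact Set.mem_biUnion (hy n) rfl
  have key : ∀ n ∈ y ⁻¹' {z}, a ^ i n = (x + z) - z * a ^ j n := by
    intro n hn
    have := hxy n
    rw [show y n = z from hn] at this
    linear_combination -this
  have hz0 : z ≠ 0 := by
    rintro rfl
    obtain ⟨n, hn⟩ := hinf.nonempty
    exact hx (i n) (by rw [zpow_natCast, key n hn]; ring)
  have hxz : x + z ≠ 0 := by
    intro h0
    obtain ⟨n, hn⟩ := hinf.nonempty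
    refine hx ((i n : ℤ) - j n) ?_
    rw [zpow_sub₀ ha0, zpow_natCast, zpow_natCast, key n hn, h0, eq_div_iff (pow_ne_zero _ ha0)]
    linear_combination a ^ j n * h0
  -- the gap `j - i` stays bounded
  set L := ‖φ a‖
  have hφz : 0 < ‖φ z‖ := norm_pos_iff.mpr ((map_ne_zero φ).mpr hz0)
  obtain ⟨J, hJ⟩ := pow_unbounded_of_one_lt (2 * ‖φ (x + z)‖ / ‖φ z‖) ha
  obtain ⟨E, hE⟩ := pow_unbounded_of_one_lt (2 / ‖φ z‖) ha
  have hgap : ∀ n ∈ y ⁻¹' {z}, J ≤ n → j n - i n < E := by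
    intro n hn hJn
    by_contra! hEn
    have h1 : φ z * φ a ^ j n = φ (x + z) - φ a ^ i n := by
      rw [← map_pow, ← map_pow, key n hn, ← map_mul, ← map_sub]
      congr 1
      ring
    have h2 : ‖φ z‖ * L ^ j n ≤ ‖φ (x + z)‖ + L ^ i n := by
      rw [← norm_pow, ← norm_mul, ← norm_pow, h1]
      exact norm_sub_le _ _
    have h3 : L ^ i n * L ^ E ≤ L ^ j n := by
      rw [← pow_add]
      exact pow_le_pow_right₀ ha.le (by have := hi n; omega)
    have h4 : L ^ J < L ^ j n := pow_lt_pow_right₀ ha (hJn.trans_lt (hj n))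
    have h5 : 0 < L ^ i n := by positivity
    rw [div_lt_iff₀ hφz] at hJ hE
    nlinarith [mul_lt_mul_of_pos_left hE h5, mul_lt_mul_of_pos_left h4 hφz]
  have hinf' : (y ⁻¹' {z} \ Set.Iio J).Infinite := hinf.sdiff (Set.finite_Iio J)
  obtain ⟨e, -, hinfe⟩ : ∃ e ∈ Set.Iio E,
      ((y ⁻¹' {z} \ Set.Iio J) ∩ (fun n => j n - i n) ⁻¹' {e}).Infinite := by
    by_contra! hfin
    refine hinf' (((Set.finite_Iio E).biUnion fun e he => hfin e he).subset fun n hn => ?_)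
    exact Set.mem_biUnion (hgap n hn.1 (not_lt.mp hn.2)) ⟨hn, rfl⟩
  obtain ⟨n, hn⟩ := hinfe.nonempty
  obtain ⟨n', hn', hlt⟩ := hinfe.exists_gt (j n)
  have hjlt : j n < j n' := hlt.trans (hj n')
  -- comparing two occurrences with the same gap
  have hd : ∀ n, j n - i n = e → a ^ j n = a ^ i n * a ^ e := fun n h => by
    rw [← pow_add]
    congr 1
    have := hi n
    omega
  have e1 := key n hn.1.1
  have e2 := key n' hn'.1.1
  rw [hd n hn.2] at e1
  rw [hd n' hn'.2] at e2
  have e3 : a ^ i n * (1 + z * a ^ e) = x + z := by linear_combination e1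
  have e4 : a ^ i n' * (1 + z * a ^ e) = x + z := by linear_combination e2
  have e5 : 1 + z * a ^ e ≠ 0 := fun h => hxz (by rw [← e3, h, mul_zero])
  have e6 : a ^ i n = a ^ i n' := mul_right_cancel₀ e5 (e3.trans e4.symm)
  have e7 : L ^ i n = L ^ i n' := by simp only [L, ← norm_pow, ← map_pow, e6]
  have e8 : i n = i n' := pow_right_injective₀ (by linarith) ha.ne' e7
  have := hi n
  have := hi n'
  have h1 : j n - i n = e := hn.2
  have h2 : j n' - i n' = e := hn'.2
  omega

open NumberField in
/-- A cyclic group of units generated by an element of infinite order is closed in the congruence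
topology of a ring of almost integral elements of a number field. -/
lemma NumberField.exists_zpow_eq_of_forall_congr {K : Type*} [Field K] [NumberField K]
    (A : Subring K) (hint : ∀ z : K, IsIntegral ℤ z → z ∈ A)
    {W : Set (FinitePlace K)} (hW : W.Finite)
    (hA : ∀ y ∈ A, ∀ v : FinitePlace K, v ∉ W → v y ≤ 1)
    (φ : K →+* ℂ) (a : Aˣ) (ha : 1 < ‖φ (a : A)‖) (x : A)
    (h : ∀ n : ℕ, n ≠ 0 → ∃ m : ℤ, (n : A) ∣ x - (a ^ m : Aˣ)) :
    ∃ m : ℤ, x = (a ^ m : Aˣ) := by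
  set b : K := ((a : A) : K) with hb
  have hroot : ∀ d : ℕ, 0 < d → b ^ d ≠ 1 := by
    intro d hd h1
    have h2 : ‖φ b‖ ^ d = 1 := by rw [← norm_pow, ← map_pow, h1, map_one, norm_one]
    exact (one_lt_pow₀ ha hd.ne').ne' h2
  have := hW.to_subtype
  obtain ⟨c, hc, hgood⟩ := AbsoluteValue.exists_pos_forall_mul_max_le
    (Sum.elim (fun v : InfinitePlace K => v.val) (fun v : W => v.1.val)) hroot
  obtain ⟨B, hB⟩ : ∃ B : ℝ, ∀ s,
      (Sum.elim (fun v : InfinitePlace K => v.val) (fun v : W => v.1.val)) s (x : K) ≤ B :=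
    (Set.finite_range _).bddAbove.imp fun B hB s => hB ⟨s, rfl⟩
  suffices hquot : ∀ J : ℕ, ∃ j > J, ∃ i < j, ∃ y ∈ {y : K | (∀ v : InfinitePlace K,
      v y ≤ (B + 1) / c) ∧ (∀ v ∈ W, v y ≤ (B + 1) / c) ∧ ∀ v : FinitePlace K, v ∉ W → v y ≤ 1},
      (x : K) - b ^ i = y * (b ^ j - 1) by
    obtain ⟨m, hm⟩ := exists_zpow_eq_of_finite_quotients φ ha
      (NumberField.finite_setOf_places_le hW ((B + 1) / c)) hquot
    refine ⟨m, Subtype.ext (hm.trans ?_)⟩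
    rw [hb]
    exact (Units.val_zpow_eq_zpow_val (Units.map (A.subtype : A →* K) a) m).symm.trans
      (congrArg Units.val (map_zpow (Units.map (A.subtype : A →* K)) a m)).symm
  intro J
  obtain ⟨j, hj, hjw⟩ := hgood J
  have hj0 : 0 < j := by omega
  have hne : b ^ j - 1 ≠ 0 := sub_ne_zero.mpr (hroot j hj0)
  obtain ⟨N, hN, hNint⟩ : ∃ N : ℕ, N ≠ 0 ∧ IsIntegral ℤ (N * (b ^ j - 1)⁻¹) := by
    obtain ⟨n, hn, -, hn'⟩ := NumberField.exists_nat_le_mulHeight₁ (b ^ j - 1)⁻¹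
    exact ⟨n, hn, hn'⟩
  -- reduce the congruence modulo `b ^ j - 1`
  obtain ⟨m, hm⟩ := h N hN
  have hdvd : ((a : A) ^ j - 1) ∣ (N : A) :=
    ⟨⟨_, hint _ hNint⟩, Subtype.ext (by push_cast; rw [← hb]; field_simp)⟩
  obtain ⟨i, hi, hxi⟩ : ∃ i < j, ((a : A) ^ j - 1) ∣ x - (a : A) ^ i := by
    let π := Ideal.Quotient.mk (Ideal.span {(a : A) ^ j - 1})
    have hπ : ∀ z, ((a : A) ^ j - 1) ∣ z ↔ π z = 0 := fun z => by
      rw [Ideal.Quotient.eq_zero_iff_mem, Ideal.mem_span_singleton]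
    have hu : (Units.map π.toMonoidHom a) ^ j = 1 := by
      ext
      have := (hπ _).mp dvd_rfl
      rw [map_sub, sub_eq_zero, map_one, map_pow] at this
      simpa using this
    obtain ⟨i, hi, hmi⟩ := exists_lt_zpow_eq_pow hj0 hu m
    refine ⟨i, hi, (hπ _).mpr ?_⟩
    have h1 := (hπ _).mp (hdvd.trans hm)
    rw [map_sub, sub_eq_zero] at h1 ⊢
    have h2 := congrArg Units.val hmi
    rw [← map_zpow, ← map_pow] at h2
    rw [h1]
    exact h2.trans (by simp)
  obtain ⟨y, hy⟩ := hxi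
  have hyK : (x : K) - b ^ i = y * (b ^ j - 1) := by
    have := congrArg (Subtype.val) hy
    push_cast at this
    rw [this, mul_comm]
  have hbound : ∀ s, (Sum.elim (fun v : InfinitePlace K => v.val) (fun v : W => v.1.val)) s (y : K)
      ≤ (B + 1) / c := by
    intro s
    set w := (Sum.elim (fun v : InfinitePlace K => v.val) (fun v : W => v.1.val)) s
    have h1 : w (x - b ^ i) ≤ (B + 1) * max 1 (w b ^ j) := by
      have h2 := w.sub_le_add (x : K) (b ^ i)
      have h3 : w b ^ i ≤ max 1 (w b ^ j) := by
        rcases le_total (w b) 1 with h | h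
        · exact (pow_le_one₀ (w.nonneg _) h).trans (le_max_left _ _)
        · exact (pow_le_pow_right₀ h hi.le).trans (le_max_right _ _)
      rw [map_pow] at h2
      have h4 : 0 ≤ B := (w.nonneg _).trans (hB s)
      nlinarith [hB s, le_max_left 1 (w b ^ j)]
    rw [hyK, map_mul] at h1
    have h5 := hjw s
    have h6 : 0 < max 1 (w b ^ j) := by positivity
    rw [le_div_iff₀ hc]
    refine le_of_mul_le_mul_right (le_trans ?_ h1) h6
    calc w (y : K) * c * max 1 (w b ^ j) = w (y : K) * (c * max 1 (w b ^ j)) := by ring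
      _ ≤ _ := mul_le_mul_of_nonneg_left h5 (w.nonneg _)
  exact ⟨j, hj, i, hi, y, ⟨fun v => hbound (Sum.inl v), fun v hv => hbound (Sum.inr ⟨v, hv⟩),
    fun v hv => hA y y.2 v hv⟩, hyK⟩

/-- The complex numbers `z` that become integral over `ℤ` after multiplication by a power
of `N`. -/
def almostIntegers (N : ℕ) : Subring ℂ where
  carrier := {z | ∃ e : ℕ, IsIntegral ℤ ((N : ℂ) ^ e * z)}
  one_mem' := ⟨0, by simpa using isIntegral_one⟩
  zero_mem' := ⟨0, by simpa using isIntegral_zero⟩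
  neg_mem' := by
    rintro z ⟨e, he⟩
    exact ⟨e, by simpa using he.neg⟩
  mul_mem' := by
    rintro y z ⟨e, he⟩ ⟨f, hf⟩
    refine ⟨e + f, ?_⟩
    have h : (N : ℂ) ^ (e + f) * (y * z) = (N : ℂ) ^ e * y * ((N : ℂ) ^ f * z) := by ring
    exact h ▸ he.mul hf
  add_mem' := by
    rintro y z ⟨e, he⟩ ⟨f, hf⟩
    refine ⟨e + f, ?_⟩
    have hN : ∀ k : ℕ, IsIntegral ℤ ((N : ℂ) ^ k) := fun k => (isIntegral_natCast N).pow k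
    have h : (N : ℂ) ^ (e + f) * (y + z) =
        (N : ℂ) ^ f * ((N : ℂ) ^ e * y) + (N : ℂ) ^ e * ((N : ℂ) ^ f * z) := by ring
    exact h ▸ ((hN f).mul he).add ((hN e).mul hf)

namespace almostIntegers

variable {N : ℕ}

lemma mem_of_isIntegral {z : ℂ} (hz : IsIntegral ℤ z) : z ∈ almostIntegers N :=
  ⟨0, by simpa using hz⟩

lemma exists_natCast_mul_isIntegral {z : ℂ} (hz : IsAlgebraic ℚ z) :
    ∃ n : ℕ, n ≠ 0 ∧ IsIntegral ℤ (n * z) := by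
  obtain ⟨y, hy, hyz⟩ :=
    ((IsFractionRing.isAlgebraic_iff ℤ ℚ ℂ).mpr hz).exists_integral_multiple
  refine ⟨y.natAbs, by simpa using hy, ?_⟩
  rcases Int.natAbs_eq y with h | h
  · rw [h] at hyz
    simpa using hyz
  · rw [h] at hyz
    simpa using hyz.neg

lemma isAlgebraic (hN : N ≠ 0) {z : ℂ} (hz : z ∈ almostIntegers N) : IsAlgebraic ℚ z := by
  obtain ⟨e, he⟩ := hz
  have h1 : IsAlgebraic ℚ ((N : ℂ) ^ e * z) := he.tower_top.isAlgebraic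
  have h2 : IsAlgebraic ℚ (((N : ℂ) ^ e)⁻¹) := ((isAlgebraic_natCast N).pow e).inv
  have h3 := h2.mul h1
  rwa [inv_mul_cancel_left₀ (by positivity)] at h3

lemma exists_forall_mem (T : Finset ℂ) (hT : ∀ z ∈ T, IsAlgebraic ℚ z) :
    ∃ N : ℕ, N ≠ 0 ∧ ∀ z ∈ T, z ∈ almostIntegers N := by
  classical
  choose! f hf0 hf using fun z hz => exists_natCast_mul_isIntegral (hT z hz)
  refine ⟨∏ z ∈ T, f z, Finset.prod_ne_zero_iff.mpr hf0, fun z hz => ⟨1, ?_⟩⟩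
  rw [← Finset.prod_erase_mul _ _ hz, pow_one, Nat.cast_mul, mul_assoc]
  exact (isIntegral_natCast _).mul (hf z hz)

/-- Only zero is divisible by every positive integer. -/
lemma eq_zero_of_forall_dvd (hN : N ≠ 0) {z : almostIntegers N}
    (hz : ∀ n : ℕ, n ≠ 0 → (n : almostIntegers N) ∣ z) : z = 0 := by
  by_contra hz0
  have hz0' : (z : ℂ) ≠ 0 := fun h => hz0 (Subtype.ext h)
  obtain ⟨n, hn, hnz⟩ := exists_natCast_mul_isIntegral (isAlgebraic hN z.2).inv
  obtain ⟨q, hqN, hq⟩ := Nat.exists_infinite_primes (N + 1)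
  obtain ⟨y, hy⟩ := hz (q * n) (mul_ne_zero hq.ne_zero hn)
  have hinv : (q : ℂ) * ((n : ℂ) * (z : ℂ)⁻¹ * y) = 1 := by
    have := congrArg Subtype.val hy
    push_cast at this
    calc (q : ℂ) * ((n : ℂ) * (z : ℂ)⁻¹ * y) = (q * n * y) * (z : ℂ)⁻¹ := by ring
      _ = 1 := by rw [← this, mul_inv_cancel₀ hz0']
  obtain ⟨e, he⟩ := mul_mem (mem_of_isIntegral (N := N) hnz) y.2
  have hq0 : (q : ℂ) ≠ 0 := by exact_mod_cast hq.ne_zero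
  rw [eq_inv_of_mul_eq_one_right hinv] at he
  have he' : IsIntegral ℤ ((N : ℚ) ^ e * (q : ℚ)⁻¹) := by
    rw [← isIntegral_algebraMap_iff (algebraMap ℚ ℂ).injective]
    simpa using he
  obtain ⟨k, hk⟩ := IsIntegrallyClosed.isIntegral_iff.mp he'
  have hk' : (N : ℚ) ^ e = k * q := by
    have hq0' : (q : ℚ) ≠ 0 := by exact_mod_cast hq.ne_zero
    rw [show (k : ℚ) = _ from hk]
    field_simp
  have hdvd : (q : ℤ) ∣ (N : ℤ) ^ e := ⟨k, by rw [mul_comm]; exact_mod_cast hk'⟩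
  have := Nat.le_of_dvd (Nat.pos_of_ne_zero hN)
    (hq.dvd_of_dvd_pow (by exact_mod_cast hdvd : q ∣ N ^ e))
  omega

/-- A number congruent to an integer modulo every positive integer is rational. -/
lemma exists_rat_eq_of_forall_congr (hN : N ≠ 0) (c : almostIntegers N)
    (hc : ∀ n : ℕ, n ≠ 0 → ∃ m : ℤ, (n : almostIntegers N) ∣ c - m) :
    ∃ r : ℚ, (c : ℂ) = r := by
  have halg := isAlgebraic hN c.2
  by_contra! hrat
  -- a conjugate `c'` of `c`
  obtain ⟨c', hc', hne⟩ : ∃ c' : ℂ, c' ∈ (minpoly ℚ (c : ℂ)).rootSet ℂ ∧ c' ≠ c := by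
    by_contra! hall
    have hcard : (minpoly ℚ (c : ℂ)).natDegree ≤ 1 := by
      rw [← Polynomial.card_rootSet_eq_natDegree (minpoly.irreducible halg.isIntegral).separable
        (IsAlgClosed.splits (k := ℂ) _), Fintype.card_le_one_iff]
      intro x y
      exact Subtype.ext ((hall x x.2).trans (hall y y.2).symm)
    have h1 : (minpoly ℚ (c : ℂ)).natDegree = 1 :=
      le_antisymm hcard (minpoly.natDegree_pos halg.isIntegral)
    obtain ⟨r, hr⟩ := minpoly.mem_range_of_degree_eq_one ℚ (c : ℂ)
      ((Polynomial.degree_eq_iff_natDegree_eq_of_pos one_pos).mpr h1)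
    exact hrat r hr.symm
  obtain ⟨σ, hσ⟩ : ∃ σ : IntermediateField.adjoin ℚ {(c : ℂ)} →ₐ[ℚ] ℂ,
      σ (IntermediateField.AdjoinSimple.gen ℚ (c : ℂ)) = c' := by
    refine ⟨(IntermediateField.algHomAdjoinIntegralEquiv ℚ halg.isIntegral).symm
      ⟨c', ?_⟩, IntermediateField.algHomAdjoinIntegralEquiv_symm_apply_gen ..⟩
    exact (Polynomial.mem_aroots').mpr (Polynomial.mem_rootSet'.mp hc')
  set g := IntermediateField.AdjoinSimple.gen ℚ (c : ℂ) with hg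
  have hσmem : ∀ y : IntermediateField.adjoin ℚ {(c : ℂ)}, (y : ℂ) ∈ almostIntegers N →
      σ y ∈ almostIntegers N := by
    rintro y ⟨e, he⟩
    refine ⟨e, ?_⟩
    have h1 : IsIntegral ℤ ((N : IntermediateField.adjoin ℚ {(c : ℂ)}) ^ e * y) := by
      rw [← isIntegral_algebraMap_iff (algebraMap (IntermediateField.adjoin ℚ {(c : ℂ)}) ℂ).injective]
      simpa using he
    simpa using h1.map (σ.restrictScalars ℤ)
  have hc'mem : c' ∈ almostIntegers N := hσ ▸ hσmem g c.2
  have hzero := eq_zero_of_forall_dvd hN (z := c - ⟨c', hc'mem⟩) fun n hn => by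
    obtain ⟨m, y, hy⟩ := hc n hn
    have hyc : (c : ℂ) - m = n * y := by simpa using congrArg Subtype.val hy
    have hn' : (n : ℂ) ≠ 0 := by exact_mod_cast hn
    let y' : IntermediateField.adjoin ℚ {(c : ℂ)} := (g - m) / n
    have hy' : (y' : ℂ) = y := by
      simp only [y', hg]
      push_cast
      rw [IntermediateField.AdjoinSimple.coe_gen, hyc]
      field_simp
    have hσy : σ y' = (c' - m) / n := by simp [y', hσ]
    refine ⟨y - ⟨σ y', hσmem y' (hy' ▸ y.2)⟩, Subtype.ext ?_⟩
    push_cast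
    rw [hσy, mul_sub, ← hyc]
    field_simp
    ring
  exact hne (congrArg Subtype.val (sub_eq_zero.mp hzero)).symm

open NumberField in
/-- An infinite cyclic group generated by a unit off the unit circle is closed in the congruence
topology of `almostIntegers N`. -/
lemma exists_zpow_eq_of_forall_congr (hN : N ≠ 0) (a : (almostIntegers N)ˣ)
    (ha : ‖((a : almostIntegers N) : ℂ)‖ ≠ 1) (x : almostIntegers N)
    (h : ∀ n : ℕ, n ≠ 0 → ∃ m : ℤ, (n : almostIntegers N) ∣ x - (a ^ m : (almostIntegers N)ˣ)) :
    ∃ m : ℤ, x = (a ^ m : (almostIntegers N)ˣ) := by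
  wlog ha1 : 1 < ‖((a : almostIntegers N) : ℂ)‖ generalizing a
  · have hinv : ((a⁻¹ : (almostIntegers N)ˣ) : ℂ) = ((a : almostIntegers N) : ℂ)⁻¹ := by
      refine eq_inv_of_mul_eq_one_left ?_
      rw [← Subring.coe_mul, Units.inv_mul, Subring.coe_one]
    have hpos : 0 < ‖((a : almostIntegers N) : ℂ)‖ := by
      rw [norm_pos_iff]
      exact fun h0 => a.ne_zero (Subtype.ext h0)
    have hlt : 1 < ‖((a⁻¹ : (almostIntegers N)ˣ) : ℂ)‖ := by
      rw [hinv, norm_inv]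
      exact (one_lt_inv₀ hpos).mpr (lt_of_le_of_ne (not_lt.mp ha1) ha)
    obtain ⟨m, hm⟩ := this a⁻¹ hlt.ne' (fun n hn => by
      obtain ⟨m, hm⟩ := h n hn
      exact ⟨-m, by simpa using hm⟩) hlt
    exact ⟨-m, by simpa using hm⟩
  let K := IntermediateField.adjoin ℚ {((a : almostIntegers N) : ℂ), (x : ℂ)}
  have : FiniteDimensional ℚ K := IntermediateField.finiteDimensional_adjoin_pair
    (isAlgebraic hN a.1.2).isIntegral (isAlgebraic hN x.2).isIntegral
  have : NumberField K := { }
  let A : Subring K := (almostIntegers N).comap (algebraMap K ℂ)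
  have hint : ∀ z : K, IsIntegral ℤ z → z ∈ A := fun z hz =>
    mem_of_isIntegral (hz.map (algebraMap K ℂ).toIntAlgHom)
  have hW : {v : FinitePlace K | v (N : K) ≠ 1}.Finite :=
    FinitePlace.hasFiniteMulSupport (by exact_mod_cast hN)
  have hA : ∀ y ∈ A, ∀ v : FinitePlace K, v ∉ {v : FinitePlace K | v (N : K) ≠ 1} → v y ≤ 1 := by
    rintro y ⟨e, he⟩ v hv
    have hv1 : v (N : K) = 1 := by simpa using hv
    have h1 : IsIntegral ℤ ((N : K) ^ e * y) := by
      rw [← isIntegral_algebraMap_iff (algebraMap K ℂ).injective]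
      simpa using he
    have h2 := FinitePlace.norm_le_one K v.maximalIdeal (⟨_, h1⟩ : 𝓞 K)
    rw [FinitePlace.norm_embedding_eq] at h2
    change v ((N : K) ^ e * y) ≤ 1 at h2
    simpa [hv1] using h2
  have haK : ((a : almostIntegers N) : ℂ) ∈ K := IntermediateField.subset_adjoin _ _ (by simp)
  have hxK : (x : ℂ) ∈ K := IntermediateField.subset_adjoin _ _ (by simp)
  have haK0 : (⟨_, haK⟩ : K) ≠ 0 := fun h0 =>
    a.ne_zero (Subtype.ext (congrArg (Subtype.val : K → ℂ) h0))
  let ι : A →+* almostIntegers N := (algebraMap K ℂ).restrict A (almostIntegers N) fun _ h => h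
  have hι : Function.Injective ι := fun y z hyz =>
    Subtype.ext ((algebraMap K ℂ).injective (congrArg (Subtype.val : almostIntegers N → ℂ) hyz))
  let b : Aˣ :=
    { val := ⟨⟨_, haK⟩, a.1.2⟩
      inv := ⟨⟨_, haK⟩⁻¹, by
        have : ((a⁻¹ : (almostIntegers N)ˣ) : ℂ) = ((a : almostIntegers N) : ℂ)⁻¹ := by
          refine eq_inv_of_mul_eq_one_left ?_
          rw [← Subring.coe_mul, Units.inv_mul, Subring.coe_one]
        change ((a : almostIntegers N) : ℂ)⁻¹ ∈ almostIntegers N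
        exact this ▸ (a⁻¹).1.2⟩
      val_inv := Subtype.ext (mul_inv_cancel₀ haK0)
      inv_val := Subtype.ext (inv_mul_cancel₀ haK0) }
  have hb : Units.map ι.toMonoidHom b = a := Units.ext rfl
  have hιb : ∀ m : ℤ, ι (b ^ m : Aˣ) = (a ^ m : (almostIntegers N)ˣ) := fun m => by
    rw [← hb, ← map_zpow]
    rfl
  obtain ⟨m, hm⟩ := NumberField.exists_zpow_eq_of_forall_congr A hint hW hA (algebraMap K ℂ) b ha1
    ⟨⟨_, hxK⟩, x.2⟩ fun n hn => by
      obtain ⟨m, y, hy⟩ := h n hn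
      have hmem : (((a ^ m : (almostIntegers N)ˣ) : almostIntegers N) : ℂ) ∈ K := by
        rw [← hιb]
        exact ((b ^ m : Aˣ) : K).2
      have hyK : (y : ℂ) ∈ K := by
        have hy' : (x : ℂ) - (a ^ m : (almostIntegers N)ˣ) = n * y := by
          simpa using congrArg Subtype.val hy
        have hn' : (n : ℂ) ≠ 0 := by exact_mod_cast hn
        rw [eq_div_of_mul_eq hn' (mul_comm _ _ |>.trans hy'.symm)]
        exact div_mem (sub_mem hxK hmem) (natCast_mem K n)
      refine ⟨m, ⟨⟨(y : ℂ), hyK⟩, y.2⟩, hι ?_⟩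
      have h1 := hιb m
      rw [map_sub, map_mul, map_natCast]
      exact (congrArg (x - ·) h1).trans hy
  exact ⟨m, by rw [← hιb, ← hm]; rfl⟩

end almostIntegers

/-- Congruence of complex numbers modulo `n` with respect to the subring `A`. -/
def CongrMod (A : Subring ℂ) (n : ℕ) (y z : ℂ) : Prop := ∃ q ∈ A, y - z = n * q

namespace CongrMod

variable {A : Subring ℂ} {n : ℕ} {x y z s t ζ : ℂ}

lemma mono {B : Subring ℂ} (hAB : A ≤ B) (h : CongrMod A n y z) : CongrMod B n y z :=
  let ⟨q, hq, e⟩ := h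
  ⟨q, hAB hq, e⟩

lemma of_dvd {k : ℕ} (hnk : n ∣ k) (h : CongrMod A k y z) : CongrMod A n y z := by
  obtain ⟨q, hq, e⟩ := h
  obtain ⟨j, rfl⟩ := hnk
  exact ⟨j * q, mul_mem (natCast_mem A j) hq, by rw [e]; push_cast; ring⟩

lemma mul_left (hx : x ∈ A) (h : CongrMod A n y z) : CongrMod A n (x * y) (x * z) := by
  obtain ⟨q, hq, e⟩ := h
  exact ⟨x * q, mul_mem hx hq, by linear_combination x * e⟩

/-- The product of congruences whose right-hand sides are twisted by a square root of `1`. -/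
lemma mul_of_sq (h1 : CongrMod A n y (ζ * s)) (h2 : CongrMod A n z (ζ * t))
    (hζ : CongrMod A n (ζ ^ 2) 1) (hζA : ζ ∈ A) (hs : s ∈ A) (ht : t ∈ A) (hz : z ∈ A) :
    CongrMod A n (y * z) (s * t) := by
  obtain ⟨q, hq, e⟩ := h1
  obtain ⟨q', hq', e'⟩ := h2
  obtain ⟨r, hr, e''⟩ := hζ
  refine ⟨q * z + ζ * s * q' + r * s * t, add_mem (add_mem (mul_mem hq hz)
    (mul_mem (mul_mem hζA hs) hq')) (mul_mem (mul_mem hr hs) ht), ?_⟩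
  linear_combination z * e + ζ * s * e' + s * t * e''

end CongrMod

/-- The complex number `z` is a unit of the subring `A`. -/
structure IsUnitIn (A : Subring ℂ) (z : ℂ) : Prop where
  ne_zero : z ≠ 0
  mem : z ∈ A
  inv_mem : z⁻¹ ∈ A

namespace IsUnitIn

variable {A : Subring ℂ} {y z : ℂ}

lemma inv (hz : IsUnitIn A z) : IsUnitIn A z⁻¹ :=
  ⟨inv_ne_zero hz.ne_zero, hz.inv_mem, by simpa using hz.mem⟩

lemma mul (hy : IsUnitIn A y) (hz : IsUnitIn A z) : IsUnitIn A (y * z) :=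
  ⟨mul_ne_zero hy.ne_zero hz.ne_zero, mul_mem hy.mem hz.mem,
    by rw [mul_inv]; exact mul_mem hy.inv_mem hz.inv_mem⟩

lemma pow (hz : IsUnitIn A z) (m : ℕ) : IsUnitIn A (z ^ m) :=
  ⟨pow_ne_zero m hz.ne_zero, pow_mem hz.mem m, by rw [← inv_pow]; exact pow_mem hz.inv_mem m⟩

lemma zpow (hz : IsUnitIn A z) : ∀ m : ℤ, IsUnitIn A (z ^ m)
  | (m : ℕ) => by simpa using hz.pow m
  | Int.negSucc m => by simpa using (hz.pow (m + 1)).inv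

end IsUnitIn

namespace almostIntegers

variable {N : ℕ}

lemma eq_of_forall_congrMod (hN : N ≠ 0) {x y : ℂ} (hx : x ∈ almostIntegers N)
    (hy : y ∈ almostIntegers N) (h : ∀ n : ℕ, n ≠ 0 → CongrMod (almostIntegers N) n x y) :
    x = y := by
  have := eq_zero_of_forall_dvd hN (z := ⟨x, hx⟩ - ⟨y, hy⟩) fun n hn => by
    obtain ⟨q, hq, e⟩ := h n hn
    exact ⟨⟨q, hq⟩, Subtype.ext (by simpa using e)⟩
  exact congrArg Subtype.val (sub_eq_zero.mp this)

lemma exists_rat_eq_of_forall_congrMod (hN : N ≠ 0) {c : ℂ} (hc : c ∈ almostIntegers N)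
    (h : ∀ n : ℕ, n ≠ 0 → ∃ m : ℤ, CongrMod (almostIntegers N) n c m) : ∃ r : ℚ, c = r :=
  exists_rat_eq_of_forall_congr hN ⟨c, hc⟩ fun n hn => by
    obtain ⟨m, q, hq, e⟩ := h n hn
    exact ⟨m, ⟨q, hq⟩, Subtype.ext (by simpa using e)⟩

lemma exists_zpow_eq_of_forall_congrMod (hN : N ≠ 0) {a x : ℂ}
    (ha : IsUnitIn (almostIntegers N) a) (ha1 : ‖a‖ ≠ 1) (hx : x ∈ almostIntegers N)
    (h : ∀ n : ℕ, n ≠ 0 → ∃ m : ℤ, CongrMod (almostIntegers N) n x (a ^ m)) :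
    ∃ m : ℤ, x = a ^ m := by
  let u : (almostIntegers N)ˣ :=
    { val := ⟨a, ha.mem⟩
      inv := ⟨a⁻¹, ha.inv_mem⟩
      val_inv := Subtype.ext (mul_inv_cancel₀ ha.ne_zero)
      inv_val := Subtype.ext (inv_mul_cancel₀ ha.ne_zero) }
  have hu : ∀ m : ℤ, (((u ^ m : (almostIntegers N)ˣ) : almostIntegers N) : ℂ) = a ^ m := fun m => by
    have := congrArg Units.val (map_zpow (Units.map (almostIntegers N).subtype.toMonoidHom) u m)
    rw [Units.val_zpow_eq_zpow_val] at this
    exact this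
  obtain ⟨m, hm⟩ := exists_zpow_eq_of_forall_congr hN u ha1 ⟨x, hx⟩ fun n hn => by
    obtain ⟨m, q, hq, e⟩ := h n hn
    exact ⟨m, ⟨q, hq⟩, Subtype.ext (by simpa [hu] using e)⟩
  exact ⟨m, by rw [← hu, ← hm]⟩

/-- A group generated by a unit off the unit circle and a root of one of its powers is closed
in the congruence topology. -/
lemma exists_zpow_mul_zpow_eq_of_forall_congrMod (hN : N ≠ 0) {a b x : ℂ}
    (ha : IsUnitIn (almostIntegers N) a) (ha1 : ‖a‖ ≠ 1) (hb : IsUnitIn (almostIntegers N) b)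
    (hx : x ∈ almostIntegers N) {q : ℕ} (hq : q ≠ 0) {p : ℤ} (hpq : b ^ q = a ^ p)
    (h : ∀ n : ℕ, n ≠ 0 → ∃ m l : ℤ, CongrMod (almostIntegers N) n x (a ^ m * b ^ l)) :
    ∃ m l : ℤ, x = a ^ m * b ^ l := by
  by_contra! hne
  have hr : ∀ r : ℕ, ∃ n : ℕ, n ≠ 0 ∧ ∀ m : ℤ,
      ¬ CongrMod (almostIntegers N) n (x * (b ^ r)⁻¹) (a ^ m) := by
    intro r
    by_contra! hr
    obtain ⟨m, hm⟩ := exists_zpow_eq_of_forall_congrMod hN ha ha1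
      (mul_mem hx (hb.pow r).inv_mem) hr
    refine hne m r ?_
    rw [zpow_natCast, ← hm, inv_mul_cancel_right₀ (hb.pow r).ne_zero]
  choose n hn0 hn using hr
  obtain ⟨m, l, hml⟩ := h (∏ r ∈ Finset.range q, n r) (Finset.prod_ne_zero_iff.mpr fun r _ => hn0 r)
  have hq' : (q : ℤ) ≠ 0 := by exact_mod_cast hq
  obtain ⟨r, hrl⟩ := Int.eq_ofNat_of_zero_le (Int.emod_nonneg l hq')
  have hrq : r < q := by
    have := Int.emod_lt_of_pos l (b := q) (by positivity)
    omega
  refine hn r (m + p * (l / q)) ?_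
  have hl : b ^ l = b ^ r * a ^ (p * (l / q)) := by
    rw [_root_.zpow_mul, ← hpq, ← zpow_natCast, ← zpow_natCast, ← _root_.zpow_mul, ← zpow_add₀ hb.ne_zero, ← hrl,
      Int.emod_add_mul_ediv]
  have h1 := (hml.of_dvd (Finset.dvd_prod_of_mem n (Finset.mem_range.mpr hrq))).mul_left
    (hb.pow r).inv_mem
  convert h1 using 1
  · ring
  · rw [hl, zpow_add₀ ha.ne_zero]
    field_simp [(hb.pow r).ne_zero]

end almostIntegers

/-- The matrix `M'` is `ζ • diag(u, u⁻¹) * M * diag(w, w⁻¹)`, up to the relation `r`. -/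
def IsTwist (r : ℂ → ℂ → Prop) (ζ u w : ℂ) (M M' : Matrix (Fin 2) (Fin 2) ℂ) : Prop :=
  ∀ i j, r (M' i j) (ζ * (![u, u⁻¹] i * ![w, w⁻¹] j * M i j))

namespace IsTwist

variable {r : ℂ → ℂ → Prop} {ζ u w : ℂ} {M M' : Matrix (Fin 2) (Fin 2) ℂ}

lemma transpose (h : IsTwist r ζ u w M M') : IsTwist r ζ w u Mᵀ M'ᵀ := fun i j => by
  simpa only [Matrix.transpose_apply, mul_comm (![w, w⁻¹] i)] using h j i

lemma swap_rows (h : IsTwist r ζ u w M M') :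
    IsTwist r ζ u⁻¹ w (M.submatrix (Equiv.swap 0 1) id) (M'.submatrix (Equiv.swap 0 1) id) := by
  intro i j
  fin_cases i
  · simpa using h 1 j
  · simpa using h 0 j

end IsTwist

lemma IsUnitIn.diag {A : Subring ℂ} {u : ℂ} (hu : IsUnitIn A u) (i : Fin 2) :
    IsUnitIn A (![u, u⁻¹] i) := by
  fin_cases i
  · exact hu
  · exact hu.inv

/-- The matrix `M'` is congruent modulo every positive integer to a twist of `M` by powers of
`α` and `β`. -/
def TwistCongr (A : Subring ℂ) (α β : ℂ) (M M' : Matrix (Fin 2) (Fin 2) ℂ) : Prop :=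
  ∀ n : ℕ, n ≠ 0 → ∃ ζ ∈ A, CongrMod A n (ζ ^ 2) 1 ∧
    ∃ m l : ℤ, IsTwist (CongrMod A n) ζ (α ^ m) (β ^ l) M M'

namespace TwistCongr

section

variable {A : Subring ℂ} {α β : ℂ} {M M' : Matrix (Fin 2) (Fin 2) ℂ}

lemma transpose (h : TwistCongr A α β M M') : TwistCongr A β α Mᵀ M'ᵀ := fun n hn => by
  obtain ⟨ζ, hζ, hζ1, m, l, h⟩ := h n hn
  exact ⟨ζ, hζ, hζ1, l, m, h.transpose⟩

lemma swap_rows (h : TwistCongr A α β M M') : TwistCongr A α⁻¹ β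
    (M.submatrix (Equiv.swap 0 1) id) (M'.submatrix (Equiv.swap 0 1) id) := fun n hn => by
  obtain ⟨ζ, hζ, hζ1, m, l, h⟩ := h n hn
  exact ⟨ζ, hζ, hζ1, m, l, by simpa only [_root_.inv_zpow] using h.swap_rows⟩

lemma mul_congr (hα : IsUnitIn A α) (hβ : IsUnitIn A β) (hM : ∀ i j, M i j ∈ A)
    (hM' : ∀ i j, M' i j ∈ A) (h : TwistCongr A α β M M') (n : ℕ) (hn : n ≠ 0) :
    ∃ m l : ℤ, ∀ i j i' j', CongrMod A n (M' i j * M' i' j')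
      ((![α ^ m, (α ^ m)⁻¹] i * ![β ^ l, (β ^ l)⁻¹] j * M i j) *
        (![α ^ m, (α ^ m)⁻¹] i' * ![β ^ l, (β ^ l)⁻¹] j' * M i' j')) := by
  obtain ⟨ζ, hζ, hζ1, m, l, h⟩ := h n hn
  have hmem : ∀ i j, ![α ^ m, (α ^ m)⁻¹] i * ![β ^ l, (β ^ l)⁻¹] j * M i j ∈ A := fun i j =>
    mul_mem (mul_mem ((hα.zpow m).diag i).mem ((hβ.zpow l).diag j).mem) (hM i j)
  exact ⟨m, l, fun i j i' j' =>
    (h i j).mul_of_sq (h i' j') hζ1 hζ (hmem i j) (hmem i' j') (hM' i' j')⟩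

end

variable {N : ℕ} {α β : ℂ} {M M' : Matrix (Fin 2) (Fin 2) ℂ}

local notation "𝔸" => almostIntegers N

lemma mul_diag_eq (hN : N ≠ 0) (hα : IsUnitIn 𝔸 α) (hβ : IsUnitIn 𝔸 β)
    (hM : ∀ i j, M i j ∈ 𝔸) (hM' : ∀ i j, M' i j ∈ 𝔸) (h : TwistCongr 𝔸 α β M M') :
    M' 0 0 * M' 1 1 = M 0 0 * M 1 1 ∧ M' 0 1 * M' 1 0 = M 0 1 * M 1 0 := by
  constructor
  · refine almostIntegers.eq_of_forall_congrMod hN (mul_mem (hM' _ _) (hM' _ _))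
      (mul_mem (hM _ _) (hM _ _)) fun n hn => ?_
    obtain ⟨m, l, h⟩ := h.mul_congr hα hβ hM hM' n hn
    convert h 0 0 1 1 using 1
    have h1 := (hα.zpow m).ne_zero
    have h2 := (hβ.zpow l).ne_zero
    simp
    field_simp
  · refine almostIntegers.eq_of_forall_congrMod hN (mul_mem (hM' _ _) (hM' _ _))
      (mul_mem (hM _ _) (hM _ _)) fun n hn => ?_
    obtain ⟨m, l, h⟩ := h.mul_congr hα hβ hM hM' n hn
    convert h 0 1 1 0 using 1
    have h1 := (hα.zpow m).ne_zero
    have h2 := (hβ.zpow l).ne_zero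
    simp
    field_simp

lemma isTwist_of_sq_eq {u w : ℂ} (hu : u ≠ 0) (hw : w ≠ 0) (ha : M 0 0 ≠ 0)
    (haa : M' 0 0 ^ 2 = (u * w * M 0 0) ^ 2) (had : M' 0 0 * M' 1 1 = M 0 0 * M 1 1)
    (hb : M' 0 0 * M' 0 1 = u ^ 2 * M 0 0 * M 0 1)
    (hc : M' 0 0 * M' 1 0 = w ^ 2 * M 0 0 * M 1 0) :
    ∃ ζ : ℂ, (ζ = 1 ∨ ζ = -1) ∧ IsTwist (· = ·) ζ u w M M' := by
  obtain ⟨ζ, hζ, ha'⟩ : ∃ ζ : ℂ, (ζ = 1 ∨ ζ = -1) ∧ M' 0 0 = ζ * (u * w * M 0 0) := by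
    rcases sq_eq_sq_iff_eq_or_eq_neg.mp haa with h | h
    · exact ⟨1, .inl rfl, by rw [h, one_mul]⟩
    · exact ⟨-1, .inr rfl, by rw [h]; ring⟩
  have hζ2 : ζ ^ 2 = 1 := by rcases hζ with rfl | rfl <;> norm_num
  have h0 : M' 0 0 ≠ 0 := by
    rw [ha']
    rcases hζ with rfl | rfl <;> simp [*]
  refine ⟨ζ, hζ, fun i j => ?_⟩
  fin_cases i <;> fin_cases j
  · exact ha'
  · refine mul_left_cancel₀ h0 (hb.trans ?_)
    rw [ha']
    simp
    field_simp
    linear_combination -M 0 1 * hζ2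
  · refine mul_left_cancel₀ h0 (hc.trans ?_)
    rw [ha']
    simp
    field_simp
    linear_combination -M 1 0 * hζ2
  · refine mul_left_cancel₀ h0 (had.trans ?_)
    rw [ha']
    simp
    field_simp
    linear_combination -M 1 1 * hζ2

lemma exists_of_apply_zero_one_ne_zero (hN : N ≠ 0) (hα : IsUnitIn 𝔸 α) (hα1 : ‖α‖ ≠ 1)
    (hβ : IsUnitIn 𝔸 β) (hβ1 : ‖β‖ ≠ 1) (hM : ∀ i j, M i j ∈ 𝔸) (hM₁ : ∀ i j, (M i j)⁻¹ ∈ 𝔸)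
    (hM' : ∀ i j, M' i j ∈ 𝔸) (h : TwistCongr 𝔸 α β M M') (ha : M 0 0 ≠ 0) (hb : M 0 1 ≠ 0) :
    ∃ ζ : ℂ, (ζ = 1 ∨ ζ = -1) ∧ ∃ m l : ℤ, IsTwist (· = ·) ζ (α ^ m) (β ^ l) M M' := by
  obtain ⟨had, hbc⟩ := h.mul_diag_eq hN hα hβ hM hM'
  obtain ⟨m, hm⟩ := almostIntegers.exists_zpow_eq_of_forall_congrMod hN (hα.pow 2)
    (by simpa using (pow_eq_one_iff_of_nonneg (norm_nonneg α) two_ne_zero).not.mpr hα1)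
    (x := (M 0 0)⁻¹ * (M 0 1)⁻¹ * (M' 0 0 * M' 0 1))
    (mul_mem (mul_mem (hM₁ _ _) (hM₁ _ _)) (mul_mem (hM' _ _) (hM' _ _))) fun n hn => by
      obtain ⟨m, l, h⟩ := h.mul_congr hα hβ hM hM' n hn
      refine ⟨m, ?_⟩
      convert (h 0 0 0 1).mul_left (mul_mem (hM₁ 0 0) (hM₁ 0 1)) using 1
      have h2 := (hβ.zpow l).ne_zero
      rw [← zpow_natCast, zpow_comm]
      simp
      field_simp
  have hm' : M' 0 0 * M' 0 1 = (α ^ m) ^ 2 * M 0 0 * M 0 1 := by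
    rw [← zpow_natCast α 2, zpow_comm, zpow_natCast] at hm
    rw [← hm]
    field_simp
  have hαm := hα.zpow m
  have hUinv := (hαm.pow 2).inv_mem
  obtain ⟨l, hl⟩ := almostIntegers.exists_zpow_eq_of_forall_congrMod hN (hβ.pow 2)
    (by simpa using (pow_eq_one_iff_of_nonneg (norm_nonneg β) two_ne_zero).not.mpr hβ1)
    (x := (M 0 0)⁻¹ * (M 0 0)⁻¹ * ((α ^ m) ^ 2)⁻¹ * (M' 0 0 * M' 0 0))
    (mul_mem (mul_mem (mul_mem (hM₁ _ _) (hM₁ _ _)) hUinv) (mul_mem (hM' _ _) (hM' _ _)))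
    fun n hn => by
      obtain ⟨k, l, h⟩ := h.mul_congr hα hβ hM hM' n hn
      refine ⟨l, ?_⟩
      obtain ⟨q, hq, e⟩ := h 0 0 0 0
      obtain ⟨q', hq', e'⟩ := h 0 0 0 1
      have h2 := hβ.zpow l
      refine ⟨(M 0 0)⁻¹ * (M 0 0)⁻¹ * ((α ^ m) ^ 2)⁻¹ * q -
        ((α ^ m) ^ 2)⁻¹ * (β ^ l) ^ 2 * ((M 0 0)⁻¹ * (M 0 1)⁻¹) * q',
        sub_mem (mul_mem (mul_mem (mul_mem (hM₁ _ _) (hM₁ _ _)) hUinv) hq)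
          (mul_mem (mul_mem (mul_mem hUinv (h2.pow 2).mem) (mul_mem (hM₁ _ _) (hM₁ _ _))) hq'), ?_⟩
      rw [← zpow_natCast β 2, zpow_comm, zpow_natCast]
      have h1 := hαm.ne_zero
      have h2 := h2.ne_zero
      simp only [cons_val_zero, cons_val_one] at e e'
      generalize α ^ m = U at *
      generalize α ^ k = u at *
      generalize β ^ l = w at *
      field_simp at e' ⊢
      linear_combination M 0 1 * e - w ^ 2 * M 0 0 * e' + w ^ 2 * M 0 0 * hm'
  have hβl := (hβ.zpow l).ne_zero
  rw [← zpow_natCast β 2, zpow_comm, zpow_natCast] at hl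
  have hl' : M' 0 0 ^ 2 = (α ^ m * β ^ l * M 0 0) ^ 2 := by
    rw [mul_pow, mul_pow, ← hl]
    have := hαm.ne_zero
    field_simp
  obtain ⟨ζ, hζ, h⟩ := isTwist_of_sq_eq hαm.ne_zero hβl ha hl' had hm' <| by
    refine mul_left_cancel₀ (mul_ne_zero (mul_ne_zero (pow_ne_zero 2 hαm.ne_zero) ha) hb) ?_
    linear_combination
      -M' 0 0 * M' 1 0 * hm' + M' 0 0 * M' 0 0 * hbc + M 0 1 * M 1 0 * hl'
  exact ⟨ζ, hζ, m, l, h⟩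

lemma exists_sq_eq_of_zpow_eq_zpow (hN : N ≠ 0) (hα : IsUnitIn 𝔸 α) (hα1 : ‖α‖ ≠ 1)
    (hβ : IsUnitIn 𝔸 β) {q : ℕ} (hq : q ≠ 0) {p : ℤ} (hpq : β ^ q = α ^ p)
    (hM : ∀ i j, M i j ∈ 𝔸) (hM₁ : ∀ i j, (M i j)⁻¹ ∈ 𝔸)
    (hM' : ∀ i j, M' i j ∈ 𝔸) (h : TwistCongr 𝔸 α β M M') (ha : M 0 0 ≠ 0) :
    ∃ m l : ℤ, M' 0 0 ^ 2 = (α ^ m * β ^ l * M 0 0) ^ 2 := by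
  obtain ⟨m, l, hml⟩ := almostIntegers.exists_zpow_mul_zpow_eq_of_forall_congrMod hN (hα.pow 2)
    (by simpa using (pow_eq_one_iff_of_nonneg (norm_nonneg α) two_ne_zero).not.mpr hα1)
    (hβ.pow 2) (x := (M 0 0)⁻¹ * (M 0 0)⁻¹ * (M' 0 0 * M' 0 0))
    (mul_mem (mul_mem (hM₁ _ _) (hM₁ _ _)) (mul_mem (hM' _ _) (hM' _ _))) hq (p := p)
    (by rw [← zpow_natCast α 2, zpow_comm, ← hpq, zpow_natCast, pow_right_comm]) fun n hn => by
      obtain ⟨m, l, h⟩ := h.mul_congr hα hβ hM hM' n hn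
      refine ⟨m, l, ?_⟩
      convert (h 0 0 0 0).mul_left (mul_mem (hM₁ 0 0) (hM₁ 0 0)) using 1
      rw [← zpow_natCast α 2, ← zpow_natCast β 2, zpow_comm, zpow_comm β]
      simp
      field_simp
  refine ⟨m, l, ?_⟩
  rw [← zpow_natCast α 2, ← zpow_natCast β 2, zpow_comm, zpow_comm β, zpow_natCast,
    zpow_natCast] at hml
  rw [mul_pow, mul_pow, ← hml]
  field_simp

lemma apply_eq_zero (hN : N ≠ 0) (hM' : ∀ i j, M' i j ∈ 𝔸) (h : TwistCongr 𝔸 α β M M')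
    {i j : Fin 2} (hij : M i j = 0) : M' i j = 0 :=
  almostIntegers.eq_of_forall_congrMod hN (hM' i j) (zero_mem _) fun n hn => by
    obtain ⟨ζ, -, -, m, l, h⟩ := h n hn
    simpa [hij] using h i j

lemma exists_isTwist_of_apply_zero_zero_ne_zero (hN : N ≠ 0) (hα : IsUnitIn 𝔸 α) (hα1 : ‖α‖ ≠ 1)
    (hβ : IsUnitIn 𝔸 β) (hβ1 : ‖β‖ ≠ 1) (hM : ∀ i j, M i j ∈ 𝔸) (hM₁ : ∀ i j, (M i j)⁻¹ ∈ 𝔸)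
    (hM' : ∀ i j, M' i j ∈ 𝔸) (h : TwistCongr 𝔸 α β M M') (ha : M 0 0 ≠ 0)
    (hax : M 0 1 = 0 → M 1 0 = 0 → ∃ q : ℕ, q ≠ 0 ∧ ∃ p : ℤ, β ^ q = α ^ p) :
    ∃ ζ : ℂ, (ζ = 1 ∨ ζ = -1) ∧ ∃ m l : ℤ, IsTwist (· = ·) ζ (α ^ m) (β ^ l) M M' := by
  by_cases hb : M 0 1 = 0
  swap
  · exact exists_of_apply_zero_one_ne_zero hN hα hα1 hβ hβ1 hM hM₁ hM' h ha hb
  by_cases hc : M 1 0 = 0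
  swap
  · obtain ⟨ζ, hζ, l, m, h⟩ := exists_of_apply_zero_one_ne_zero hN hβ hβ1 hα hα1
      (fun i j => hM j i) (fun i j => hM₁ j i) (fun i j => hM' j i) h.transpose ha hc
    exact ⟨ζ, hζ, m, l, fun i j => h.transpose i j⟩
  obtain ⟨q, hq, p, hpq⟩ := hax hb hc
  obtain ⟨m, l, hml⟩ := exists_sq_eq_of_zpow_eq_zpow hN hα hα1 hβ hq hpq hM hM₁ hM' h ha
  obtain ⟨ζ, hζ, h⟩ := isTwist_of_sq_eq (hα.zpow m).ne_zero (hβ.zpow l).ne_zero ha hml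
    (h.mul_diag_eq hN hα hβ hM hM').1
    (by rw [h.apply_eq_zero hN hM' hb, hb]; ring) (by rw [h.apply_eq_zero hN hM' hc, hc]; ring)
  exact ⟨ζ, hζ, m, l, h⟩

lemma exists_isTwist_of_swap_rows
    (h : ∃ ζ : ℂ, (ζ = 1 ∨ ζ = -1) ∧ ∃ m l : ℤ, IsTwist (· = ·) ζ (α⁻¹ ^ m) (β ^ l)
      (M.submatrix (Equiv.swap 0 1) id) (M'.submatrix (Equiv.swap 0 1) id)) :
    ∃ ζ : ℂ, (ζ = 1 ∨ ζ = -1) ∧ ∃ m l : ℤ, IsTwist (· = ·) ζ (α ^ m) (β ^ l) M M' := by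
  obtain ⟨ζ, hζ, m, l, h⟩ := h
  refine ⟨ζ, hζ, m, l, ?_⟩
  have h' := h.swap_rows
  rw [_root_.inv_zpow, inv_inv] at h'
  intro i j
  simpa using h' i j

/-- If `M'` is congruent to twists of `M` modulo every positive integer, then it is a twist of `M`,
up to sign. -/
theorem exists_isTwist (hN : N ≠ 0) (hα : IsUnitIn 𝔸 α) (hα1 : ‖α‖ ≠ 1)
    (hβ : IsUnitIn 𝔸 β) (hβ1 : ‖β‖ ≠ 1) (hM : ∀ i j, M i j ∈ 𝔸) (hM₁ : ∀ i j, (M i j)⁻¹ ∈ 𝔸)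
    (hM' : ∀ i j, M' i j ∈ 𝔸) (h : TwistCongr 𝔸 α β M M') (hdet : M 0 0 ≠ 0 ∨ M 1 0 ≠ 0)
    (hdiag : M 0 1 = 0 → M 1 0 = 0 → ∃ q : ℕ, q ≠ 0 ∧ ∃ p : ℤ, β ^ q = α ^ p)
    (hanti : M 0 0 = 0 → M 1 1 = 0 → ∃ q : ℕ, q ≠ 0 ∧ ∃ p : ℤ, β ^ q = α ^ p) :
    ∃ ζ : ℂ, (ζ = 1 ∨ ζ = -1) ∧ ∃ m l : ℤ, IsTwist (· = ·) ζ (α ^ m) (β ^ l) M M' := by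
  by_cases ha : M 0 0 = 0
  swap
  · exact exists_isTwist_of_apply_zero_zero_ne_zero hN hα hα1 hβ hβ1 hM hM₁ hM' h ha hdiag
  refine exists_isTwist_of_swap_rows <| exists_isTwist_of_apply_zero_zero_ne_zero hN hα.inv
    (by simpa using hα1) hβ hβ1 (fun i j => hM _ _) (fun i j => hM₁ _ _) (fun i j => hM' _ _)
    h.swap_rows (by simpa [ha] using hdet) fun hd _ => ?_
  obtain ⟨q, hq, p, hpq⟩ := hanti ha (by simpa using hd)
  exact ⟨q, hq, -p, by rw [_root_.inv_zpow, _root_.zpow_neg, inv_inv, hpq]⟩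

/-- A version of `TwistCongr.exists_isTwist` for single columns. -/
theorem exists_isTwist_column (hN : N ≠ 0) (hα : IsUnitIn 𝔸 α) (hα1 : ‖α‖ ≠ 1)
    (hM : ∀ i j, M i j ∈ 𝔸) (hM₁ : ∀ i j, (M i j)⁻¹ ∈ 𝔸)
    (hM' : ∀ i j, M' i j ∈ 𝔸) (h : TwistCongr 𝔸 α 1 M M') (hdet : M 0 0 ≠ 0 ∨ M 1 0 ≠ 0)
    (h01 : M 0 1 = 0) (h11 : M 1 1 = 0) :
    ∃ ζ : ℂ, (ζ = 1 ∨ ζ = -1) ∧ ∃ m l : ℤ, IsTwist (· = ·) ζ (α ^ m) (1 ^ l) M M' := by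
  have h1 : IsUnitIn 𝔸 1 := ⟨one_ne_zero, one_mem _, by simp⟩
  wlog ha : M 0 0 ≠ 0 generalizing M M' α
  · exact exists_isTwist_of_swap_rows <| this hα.inv (by simpa using hα1) (fun i j => hM _ _)
      (fun i j => hM₁ _ _) (fun i j => hM' _ _) h.swap_rows (by simpa using hdet.symm)
      (by simpa using h11) (by simpa using h01) (by simpa using hdet.resolve_left ha)
  obtain ⟨m, l, hml⟩ := exists_sq_eq_of_zpow_eq_zpow hN hα hα1 h1 one_ne_zero (p := 0) (by simp)
    hM hM₁ hM' h ha
  obtain ⟨ζ, hζ, h⟩ := isTwist_of_sq_eq (hα.zpow m).ne_zero (h1.zpow l).ne_zero ha hml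
    (h.mul_diag_eq hN hα h1 hM hM').1
    (by rw [h.apply_eq_zero hN hM' h01, h01]; ring) <|
    almostIntegers.eq_of_forall_congrMod hN (mul_mem (hM' _ _) (hM' _ _))
      (mul_mem (mul_mem ((h1.zpow l).pow 2).mem (hM _ _)) (hM _ _)) fun n hn => by
      obtain ⟨k, j, h⟩ := h.mul_congr hα h1 hM hM' n hn
      convert h 0 0 1 0 using 1
      have h1 := (hα.zpow k).ne_zero
      simp
      field_simp
  exact ⟨ζ, hζ, m, l, h⟩

end TwistCongr

lemma PSL2.mk_eq_mk_iff {R : Type} [CommRing R] {X Y : Matrix.SpecialLinearGroup (Fin 2) R} :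
    (QuotientGroup.mk X : PSL2 R) = QuotientGroup.mk Y ↔
      ∃ ζ : R, ζ ^ 2 = 1 ∧ ∀ i j, Y i j = ζ * X i j := by
  rw [QuotientGroup.eq, Matrix.SpecialLinearGroup.mem_center_iff, Fintype.card_fin]
  refine exists_congr fun ζ => and_congr_right fun _ => ?_
  have hX : (X : Matrix (Fin 2) (Fin 2) R) * (X⁻¹ : Matrix.SpecialLinearGroup (Fin 2) R) = 1 := by
    rw [← Matrix.SpecialLinearGroup.coe_mul, mul_inv_cancel, Matrix.SpecialLinearGroup.coe_one]
  have hX' : ((X⁻¹ : Matrix.SpecialLinearGroup (Fin 2) R) : Matrix (Fin 2) (Fin 2) R) * X = 1 := by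
    rw [← Matrix.SpecialLinearGroup.coe_mul, inv_mul_cancel, Matrix.SpecialLinearGroup.coe_one]
  rw [Matrix.SpecialLinearGroup.coe_mul]
  constructor
  · intro h i j
    have h1 : (Y : Matrix (Fin 2) (Fin 2) R) = X * scalar (Fin 2) ζ := by
      rw [h, ← Matrix.mul_assoc, hX, Matrix.one_mul]
    rw [h1, Matrix.scalar_apply, Matrix.mul_diagonal, mul_comm]
  · intro h
    have h1 : (Y : Matrix (Fin 2) (Fin 2) R) = X * scalar (Fin 2) ζ := by
      ext i j
      rw [h, Matrix.scalar_apply, Matrix.mul_diagonal, mul_comm]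
    rw [h1, ← Matrix.mul_assoc, hX', Matrix.one_mul]

lemma PSL2C.mk_eq_mk_iff {X Y : SL2C} : (QuotientGroup.mk X : PSL2C) = QuotientGroup.mk Y ↔
    ∃ ζ : ℂ, (ζ = 1 ∨ ζ = -1) ∧ ∀ i j, Y i j = ζ * X i j := by
  rw [show (QuotientGroup.mk X : PSL2C) = QuotientGroup.mk Y ↔ _ from PSL2.mk_eq_mk_iff]
  simp only [← sq_eq_one_iff]

/-- The congruence homomorphism modulo `I`. -/
lemma exists_congruenceHom {R : Subring ℂ} {Γ : Subgroup PSL2C} (hΓR : ContainedInPSL2 R Γ)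
    (I : Ideal R) : ∃ η : ↥Γ →* PSL2 (↥R ⧸ I),
      ∀ (x : ↥Γ) (A : Matrix.SpecialLinearGroup (Fin 2) ↥R),
        (QuotientGroup.mk (Matrix.SpecialLinearGroup.map R.subtype A) : PSL2C) = (x : PSL2C) →
        η x = QuotientGroup.mk (Matrix.SpecialLinearGroup.map (Ideal.Quotient.mk I) A) := by
  choose L hL using hΓR
  have hwd : ∀ A B : Matrix.SpecialLinearGroup (Fin 2) R,
      (QuotientGroup.mk (Matrix.SpecialLinearGroup.map R.subtype A) : PSL2C) =
        QuotientGroup.mk (Matrix.SpecialLinearGroup.map R.subtype B) →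
      (QuotientGroup.mk (Matrix.SpecialLinearGroup.map (Ideal.Quotient.mk I) A) : PSL2 (R ⧸ I)) =
        QuotientGroup.mk (Matrix.SpecialLinearGroup.map (Ideal.Quotient.mk I) B) := by
    intro A B hAB
    obtain ⟨ζ, hζ, h⟩ := PSL2C.mk_eq_mk_iff.mp hAB
    obtain ⟨z, hz, rfl⟩ : ∃ z : R, z ^ 2 = 1 ∧ (z : ℂ) = ζ := by
      rcases hζ with rfl | rfl
      · exact ⟨1, one_pow 2, rfl⟩
      · exact ⟨-1, neg_one_sq, rfl⟩
    refine PSL2.mk_eq_mk_iff.mpr ⟨Ideal.Quotient.mk I z, by rw [← map_pow, hz, map_one], ?_⟩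
    intro i j
    have h1 : B i j = z * A i j := Subtype.ext (h i j)
    exact (congrArg (Ideal.Quotient.mk I) h1).trans (map_mul _ _ _)
  refine ⟨MonoidHom.mk' (fun x => QuotientGroup.mk
    (Matrix.SpecialLinearGroup.map (Ideal.Quotient.mk I) (L x))) fun x y => ?_, fun x A hA =>
    hwd _ _ ((hL x).trans hA.symm)⟩
  rw [← QuotientGroup.mk_mul, ← map_mul]
  refine hwd _ _ ?_
  rw [hL, map_mul, QuotientGroup.mk_mul, hL, hL]
  rfl

/-- If no congruence homomorphism modulo an integer separates `γ` from `X`, then `γ` is congruent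
to elements of `X` modulo every positive integer. -/
lemma exists_congrMod_of_not_congruenceClosed {R : Subring ℂ} {Γ : Subgroup PSL2C}
    (hΓR : ContainedInPSL2 R Γ) {X : Set Γ} {γ : Γ}
    (h : ¬ ∃ I : Ideal ↥R, I ≠ ⊥ ∧ ∃ η : ↥Γ →* PSL2 (↥R ⧸ I),
      (∀ (x : ↥Γ) (A : Matrix.SpecialLinearGroup (Fin 2) ↥R),
        (QuotientGroup.mk (Matrix.SpecialLinearGroup.map R.subtype A) : PSL2C) = (x : PSL2C) →
        η x = QuotientGroup.mk (Matrix.SpecialLinearGroup.map (Ideal.Quotient.mk I) A)) ∧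
      η γ ∉ η '' X) (n : ℕ) (hn : n ≠ 0) :
    ∃ x ∈ X, ∀ Y Z : SL2C, (QuotientGroup.mk Y : PSL2C) = γ → (QuotientGroup.mk Z : PSL2C) = x →
      ∃ ζ ∈ R, CongrMod R n (ζ ^ 2) 1 ∧ ∀ i j, CongrMod R n (Y i j) (ζ * Z i j) := by
  let I : Ideal R := Ideal.span {(n : R)}
  have hI : I ≠ ⊥ := by
    rw [Ne, Ideal.span_singleton_eq_bot]
    exact_mod_cast hn
  obtain ⟨η, hη⟩ := exists_congruenceHom hΓR I
  obtain ⟨x, hx, hxγ⟩ : η γ ∈ η '' X := by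
    by_contra hγ
    exact h ⟨I, hI, η, hη, hγ⟩
  refine ⟨x, hx, fun Y Z hY hZ => ?_⟩
  obtain ⟨A, hA⟩ := hΓR γ
  obtain ⟨B, hB⟩ := hΓR x
  rw [hη γ A hA, hη x B hB] at hxγ
  obtain ⟨ζ, hζ, hBA⟩ := PSL2.mk_eq_mk_iff.mp hxγ
  obtain ⟨z, rfl⟩ := Ideal.Quotient.mk_surjective ζ
  have hdvd : ∀ a b : R, Ideal.Quotient.mk I a = Ideal.Quotient.mk I b →
      CongrMod R n a b := fun a b hab => by
    obtain ⟨q, hq⟩ := Ideal.mem_span_singleton.mp ((Ideal.Quotient.mk_eq_mk_iff_sub_mem a b).mp hab)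
    exact ⟨q, q.2, by simpa using congrArg Subtype.val hq⟩
  obtain ⟨ε, hε, hYA⟩ := PSL2C.mk_eq_mk_iff.mp (hA.trans hY.symm)
  obtain ⟨δ, hδ, hBZ⟩ := PSL2C.mk_eq_mk_iff.mp (hZ.trans hB.symm)
  have hmem : ∀ ε : ℂ, (ε = 1 ∨ ε = -1) → ε ∈ R := fun ε hε => by
    rcases hε with rfl | rfl
    · exact one_mem R
    · exact neg_mem (one_mem R)
  have hz : CongrMod R n ((z : ℂ) ^ 2) 1 :=
    hdvd (z ^ 2) 1 (by rw [map_pow, hζ, map_one])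
  refine ⟨ε * δ * z, mul_mem (mul_mem (hmem ε hε) (hmem δ hδ)) z.2, ?_, fun i j => ?_⟩
  · rwa [mul_pow, mul_pow, sq_eq_one_iff.mpr hε,
      sq_eq_one_iff.mpr hδ, one_mul, one_mul]
  · have h1 := (hdvd (A i j) (z * B i j) (by rw [map_mul]; exact hBA i j)).mul_left (hmem ε hε)
    have h2 : (B i j : ℂ) = δ * Z i j := hBZ i j
    have h3 : Y i j = ε * A i j := hYA i j
    rw [h3]
    convert h1 using 1
    rw [Subring.coe_mul, h2]
    ring

/-- The matrices in `SL(2, ℂ)` with entries in the subring `A`. -/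
def SL2Over (A : Subring ℂ) : Subgroup SL2C :=
  (Matrix.SpecialLinearGroup.map A.subtype).range

lemma mem_SL2Over {A : Subring ℂ} {X : SL2C} : X ∈ SL2Over A ↔ ∀ i j, X i j ∈ A := by
  constructor
  · rintro ⟨Y, rfl⟩ i j
    exact (Y i j).2
  · intro h
    refine ⟨⟨Matrix.of fun i j => ⟨X i j, h i j⟩, Subtype.ext ?_⟩, ?_⟩
    · have := X.det_coe
      rw [Matrix.det_fin_two] at this ⊢
      exact this
    · ext i j
      rfl

/-- The diagonal matrices in `SL(2, ℂ)`. -/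
noncomputable def diagSL : ℂˣ →* SL2C where
  toFun z := ⟨!![(z : ℂ), 0; 0, (z : ℂ)⁻¹], by simp⟩
  map_one' := by
    ext i j
    fin_cases i <;> fin_cases j <;> simp
  map_mul' y z := Subtype.ext <| by
    change !![_, _; _, _] = (!![_, _; _, _] * !![_, _; _, _] : Matrix (Fin 2) (Fin 2) ℂ)
    simp [mul_comm]

/-- The upper unitriangular matrices in `SL(2, ℂ)`. -/
noncomputable def unipSL : Multiplicative ℂ →* SL2C where
  toFun v := ⟨!![1, v.toAdd; 0, 1], by simp⟩
  map_one' := by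
    ext i j
    fin_cases i <;> fin_cases j <;> simp
  map_mul' y z := Subtype.ext <| by
    change !![_, _; _, _] = (!![_, _; _, _] * !![_, _; _, _] : Matrix (Fin 2) (Fin 2) ℂ)
    simp [add_comm]

lemma coe_diagSL (z : ℂˣ) :
    (diagSL z : Matrix (Fin 2) (Fin 2) ℂ) = !![(z : ℂ), 0; 0, (z : ℂ)⁻¹] := rfl

lemma coe_unipSL (v : Multiplicative ℂ) :
    (unipSL v : Matrix (Fin 2) (Fin 2) ℂ) = !![1, v.toAdd; 0, 1] := rfl

/-- The subring of algebraic numbers. -/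
noncomputable abbrev algebraicNumbers : Subring ℂ := (algebraicClosure ℚ ℂ).toSubfield.toSubring

lemma algebraicNumbers.div_mem {y z : ℂ} (hy : y ∈ algebraicNumbers) (hz : z ∈ algebraicNumbers) :
    y / z ∈ algebraicNumbers :=
  (algebraicClosure ℚ ℂ).div_mem hy hz

lemma exists_conj_apply_one_zero_eq_zero {G : SL2C} (hG : G ∈ SL2Over algebraicNumbers) :
    ∃ E ∈ SL2Over algebraicNumbers, (E⁻¹ * G * E) 1 0 = 0 := by
  by_cases hc : G 1 0 = 0
  · exact ⟨1, one_mem _, by simpa using hc⟩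
  have hG' := mem_SL2Over.mp hG
  have hdet := G.det_coe
  rw [Matrix.det_fin_two] at hdet
  obtain ⟨s, hs⟩ := IsAlgClosed.exists_pow_nat_eq ((G 0 0 + G 1 1) ^ 2 - 4) two_pos
  have h4 : (4 : ℂ) ∈ algebraicNumbers := by exact_mod_cast natCast_mem algebraicNumbers 4
  have h2 : (2 : ℂ) ∈ algebraicNumbers := by exact_mod_cast natCast_mem algebraicNumbers 2
  have hsA : s ∈ algebraicNumbers := by
    refine mem_algebraicClosure_iff.mpr (IsAlgebraic.of_pow two_pos ?_)
    rw [hs]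
    exact mem_algebraicClosure_iff.mp
      (sub_mem (pow_mem (add_mem (hG' _ _) (hG' _ _)) 2) h4 : _ ∈ algebraicNumbers)
  obtain ⟨x, hx, hxeq⟩ : ∃ x ∈ algebraicNumbers, G 1 0 * x ^ 2 + (G 1 1 - G 0 0) * x - G 0 1 = 0 := by
    refine ⟨(G 0 0 - G 1 1 + s) / (2 * G 1 0), algebraicNumbers.div_mem
      (add_mem (sub_mem (hG' _ _) (hG' _ _)) hsA) (mul_mem h2 (hG' _ _)), ?_⟩
    field_simp
    linear_combination hs + 4 * hdet
  obtain ⟨E, hE⟩ : ∃ E : SL2C, (E : Matrix (Fin 2) (Fin 2) ℂ) = !![x, -1; 1, 0] :=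
    ⟨⟨!![x, -1; 1, 0], by simp⟩, rfl⟩
  refine ⟨E, mem_SL2Over.mpr fun i j => ?_, ?_⟩
  · rw [hE]
    fin_cases i <;> fin_cases j
    · exact hx
    · exact neg_mem (one_mem _)
    · exact one_mem _
    · exact zero_mem _
  · rw [Matrix.SpecialLinearGroup.coe_mul, Matrix.SpecialLinearGroup.coe_mul,
      Matrix.SpecialLinearGroup.coe_inv, Matrix.adjugate_fin_two, hE]
    simp [Matrix.mul_apply, Matrix.vecMul, dotProduct, Fin.sum_univ_two]
    linear_combination hxeq

lemma trace_conj (G E : SL2C) : Matrix.trace ((E⁻¹ * G * E : SL2C) : Matrix (Fin 2) (Fin 2) ℂ) =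
    Matrix.trace (G : Matrix (Fin 2) (Fin 2) ℂ) := by
  rw [Matrix.SpecialLinearGroup.coe_mul, Matrix.trace_mul_comm,
    ← Matrix.SpecialLinearGroup.coe_mul, ← mul_assoc, mul_inv_cancel, one_mul]

/-- A loxodromic matrix with algebraic entries can be diagonalized over the algebraic numbers. -/
lemma exists_eq_conj_diagSL {G : SL2C} (hG : G ∈ SL2Over algebraicNumbers)
    (htr : ∀ r : ℝ, 0 ≤ r → r ≤ 4 → (Matrix.trace (G : Matrix (Fin 2) (Fin 2) ℂ)) ^ 2 ≠ (r : ℂ)) :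
    ∃ E ∈ SL2Over algebraicNumbers, ∃ α : ℂˣ, ‖(α : ℂ)‖ ≠ 1 ∧ G = E * diagSL α * E⁻¹ := by
  obtain ⟨E, hE, h10⟩ := exists_conj_apply_one_zero_eq_zero hG
  rw [← trace_conj G E] at htr
  have hT := mem_SL2Over.mp (mul_mem (mul_mem (inv_mem hE) hG) hE)
  obtain ⟨T, hTdef⟩ : ∃ T, T = E⁻¹ * G * E := ⟨_, rfl⟩
  rw [← hTdef] at hT htr h10
  have hdet := T.det_coe
  rw [Matrix.det_fin_two, h10, mul_zero, sub_zero] at hdet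
  rw [Matrix.trace_fin_two] at htr
  have hμ : T 1 1 = (T 0 0)⁻¹ := eq_inv_of_mul_eq_one_right hdet
  have hne : T 0 0 ≠ 0 := left_ne_zero_of_mul_eq_one hdet
  have hne' : T 0 0 - T 1 1 ≠ 0 := fun h => by
    refine htr 4 (by norm_num) le_rfl ?_
    push_cast
    linear_combination (T 0 0 - T 1 1) * h + 4 * hdet
  let s : ℂ := -T 0 1 / (T 0 0 - T 1 1)
  have hs : s ∈ algebraicNumbers :=
    algebraicNumbers.div_mem (neg_mem (hT _ _)) (sub_mem (hT _ _) (hT _ _))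
  have hU : unipSL (.ofAdd s) ∈ SL2Over algebraicNumbers := mem_SL2Over.mpr fun i j => by
    fin_cases i <;> fin_cases j
    · exact one_mem _
    · exact hs
    · exact zero_mem _
    · exact one_mem _
  obtain ⟨α, hα⟩ : ∃ α : ℂˣ, (α : ℂ) = T 0 0 := ⟨Units.mk0 _ hne, rfl⟩
  refine ⟨E * unipSL (.ofAdd s), mul_mem hE hU, α, fun hnorm => ?_, ?_⟩
  · rw [hα] at hnorm
    have h1 : T 0 0 + T 1 1 = ((2 * (T 0 0).re : ℝ) : ℂ) := by
      rw [hμ, Complex.inv_eq_conj hnorm, Complex.add_conj]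
    refine htr ((2 * (T 0 0).re) ^ 2) (by positivity) ?_ (by rw [h1]; push_cast; ring)
    have h2 := Complex.abs_re_le_norm (T 0 0)
    rw [hnorm, abs_le] at h2
    nlinarith
  · have hTU : T * unipSL (.ofAdd s) = unipSL (.ofAdd s) * diagSL α := by
      ext i j
      rw [Matrix.SpecialLinearGroup.coe_mul, Matrix.SpecialLinearGroup.coe_mul, coe_unipSL,
        coe_diagSL, hα]
      fin_cases i <;> fin_cases j <;> simp [Matrix.mul_apply, Fin.sum_univ_two, h10, ← hμ]
      simp only [s]
      field_simp
      ring
    rw [_root_.mul_inv_rev, mul_assoc E, ← hTU, hTdef]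
    group

/-- A matrix of trace `2` with algebraic entries is unipotent over the algebraic numbers. -/
lemma exists_eq_conj_unipSL {G : SL2C} (hG : G ∈ SL2Over algebraicNumbers)
    (htr : Matrix.trace (G : Matrix (Fin 2) (Fin 2) ℂ) = 2) :
    ∃ E ∈ SL2Over algebraicNumbers, ∃ v : Multiplicative ℂ, G = E * unipSL v * E⁻¹ := by
  obtain ⟨E, hE, h10⟩ := exists_conj_apply_one_zero_eq_zero hG
  rw [← trace_conj G E] at htr
  obtain ⟨T, hTdef⟩ : ∃ T, T = E⁻¹ * G * E := ⟨_, rfl⟩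
  rw [← hTdef] at htr h10
  have hdet := T.det_coe
  rw [Matrix.det_fin_two, h10, mul_zero, sub_zero] at hdet
  rw [Matrix.trace_fin_two] at htr
  have h00 : T 0 0 = 1 := by
    have : (T 0 0 - 1) ^ 2 = 0 := by linear_combination T 0 0 * htr - hdet
    linear_combination pow_eq_zero_iff two_ne_zero |>.mp this
  have h11 : T 1 1 = 1 := by linear_combination htr - h00
  refine ⟨E, hE, .ofAdd (T 0 1), ?_⟩
  have hT : T = unipSL (.ofAdd (T 0 1)) := by
    ext i j
    fin_cases i <;> fin_cases j
    · exact h00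
    · rfl
    · exact h10
    · exact h11
  rw [← hT, hTdef]
  group

/-- The one-parameter group of classes of matrices conjugate to diagonal ones by `E`. -/
noncomputable def diagPSL (E : SL2C) : ℂˣ →* PSL2C :=
  (QuotientGroup.mk' _).comp ((MulAut.conj E).toMonoidHom.comp diagSL)

lemma diagPSL_apply (E : SL2C) (z : ℂˣ) :
    diagPSL E z = (QuotientGroup.mk (E * diagSL z * E⁻¹) : PSL2C) := rfl

lemma continuous_diagPSL (E : SL2C) : Continuous (diagPSL E) := by
  refine continuous_quot_mk.comp (continuous_induced_rng.mpr ?_)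
  change Continuous fun z : ℂˣ => (E : Matrix (Fin 2) (Fin 2) ℂ) * !![(z : ℂ), 0; 0, (z : ℂ)⁻¹] *
    (E⁻¹ : SL2C)
  refine Continuous.matrix_mul (continuous_const.matrix_mul ?_) continuous_const
  refine continuous_matrix fun i j => ?_
  fin_cases i <;> fin_cases j
  · exact Units.continuous_val
  · exact continuous_const
  · exact continuous_const
  · exact Units.continuous_val.inv₀ fun z => z.ne_zero

lemma sq_eq_one_of_diagPSL_eq_one {E : SL2C} {z : ℂˣ} (h : diagPSL E z = 1) : (z : ℂ) ^ 2 = 1 := by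
  rw [diagPSL_apply, ← QuotientGroup.mk_one, eq_comm] at h
  obtain ⟨ζ, hζ, h⟩ := PSL2C.mk_eq_mk_iff.mp h
  have h1 : trace ((E * diagSL z * E⁻¹ : SL2C) : Matrix (Fin 2) (Fin 2) ℂ) = z + (z : ℂ)⁻¹ := by
    have := trace_conj (diagSL z) E⁻¹
    rw [inv_inv] at this
    rw [this, coe_diagSL, trace_fin_two]
    simp
  rw [trace_fin_two, h, h] at h1
  have hz : (z : ℂ) ≠ 0 := z.ne_zero
  simp at h1
  have h2 : (z - ζ : ℂ) ^ 2 = 0 := by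
    field_simp at h1
    have := sq_eq_one_iff.mpr hζ
    linear_combination this - h1
  have h3 : (z : ℂ) = ζ := sub_eq_zero.mp (pow_eq_zero_iff two_ne_zero |>.mp h2)
  rw [h3, sq_eq_one_iff.mpr hζ]

/-- Eigenvalues of elements of a discrete group with common axis are multiplicatively dependent. -/
lemma exists_pow_eq_zpow_of_mem_discrete {Γ : Subgroup PSL2C} (hΓ : DiscreteTopology Γ) {E : SL2C}
    {α β : ℂˣ} (hα1 : ‖(α : ℂ)‖ ≠ 1) (hα : diagPSL E α ∈ Γ) (hβ : diagPSL E β ∈ Γ) :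
    ∃ q : ℕ, q ≠ 0 ∧ ∃ p : ℤ, (β : ℂ) ^ q = (α : ℂ) ^ p := by
  wlog h1 : 1 < ‖(α : ℂ)‖ generalizing α
  · have h2 : 1 < ‖((α⁻¹ : ℂˣ) : ℂ)‖ := by
      rw [Units.val_inv_eq_inv_val, norm_inv]
      exact (one_lt_inv₀ (norm_pos_iff.mpr α.ne_zero)).mpr (lt_of_le_of_ne (not_lt.mp h1) hα1)
    obtain ⟨q, hq, p, hp⟩ := this h2.ne' (by rw [map_inv]; exact inv_mem hα) h2
    refine ⟨q, hq, -p, ?_⟩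
    rw [hp, Units.val_inv_eq_inv_val, _root_.inv_zpow, _root_.zpow_neg]
  have hex : ∀ q : ℕ, ∃ p : ℤ, 1 ≤ ‖((β ^ q * α ^ p : ℂˣ) : ℂ)‖ ∧
      ‖((β ^ q * α ^ p : ℂˣ) : ℂ)‖ ≤ ‖(α : ℂ)‖ := fun q => by
    obtain ⟨p, hp1, hp2⟩ := exists_mem_Ico_zpow (norm_pos_iff.mpr (β ^ q).ne_zero) h1
    have hpos : 0 < ‖(α : ℂ)‖ ^ p := zpow_pos (by positivity) _
    have : ‖((β ^ q * α ^ (-p) : ℂˣ) : ℂ)‖ = ‖((β ^ q : ℂˣ) : ℂ)‖ / ‖(α : ℂ)‖ ^ p := by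
      rw [Units.val_mul, norm_mul, Units.val_zpow_eq_zpow_val, norm_zpow, _root_.zpow_neg,
        div_eq_mul_inv]
    refine ⟨-p, ?_, ?_⟩
    · rw [this, one_le_div hpos]
      exact hp1
    · rw [this, div_le_iff₀ hpos]
      refine hp2.le.trans_eq ?_
      rw [zpow_add_one₀ (by positivity), mul_comm]
  choose p hp1 hp2 using hex
  set z : ℕ → ℂˣ := fun q => β ^ q * α ^ p q with hz
  have hK : IsCompact (Metric.closedBall (0 : ℂ) ‖(α : ℂ)‖ \ Metric.ball 0 1) :=
    (isCompact_closedBall _ _).diff Metric.isOpen_ball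
  obtain ⟨a, ha, φ, hφ, hlim⟩ := hK.tendsto_subseq (x := fun q => (z q : ℂ)) fun q => by
    simpa using ⟨hp2 q, hp1 q⟩
  have ha0 : a ≠ 0 := by
    rintro rfl
    simp at ha
  have hlim1 : Filter.Tendsto (fun n => (z (φ n))⁻¹ * z (φ (n + 1))) Filter.atTop (nhds 1) := by
    rw [Units.isEmbedding_val₀.tendsto_nhds_iff]
    have := (hlim.inv₀ ha0).mul (hlim.comp (Filter.tendsto_add_atTop_nat 1))
    rw [inv_mul_cancel₀ ha0] at this
    refine this.congr fun n => ?_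
    simp
  obtain ⟨U, hU, hUΓ⟩ := isOpen_induced_iff.mp (isOpen_discrete ({1} : Set Γ))
  have hU1 : U ∈ nhds (diagPSL E 1) := by
    rw [map_one]
    refine hU.mem_nhds ?_
    have : (1 : Γ) ∈ Subtype.val ⁻¹' U := by rw [hUΓ]; rfl
    exact this
  obtain ⟨n, hn⟩ := (((continuous_diagPSL E).tendsto 1).comp hlim1 |>.eventually hU1).exists
  have hzΓ : ∀ q, diagPSL E (z q) ∈ Γ := fun q => by
    rw [hz, map_mul, map_pow, map_zpow]
    exact mul_mem (pow_mem hβ _) (zpow_mem hα _)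
  have hmem : diagPSL E ((z (φ n))⁻¹ * z (φ (n + 1))) ∈ Γ := by
    rw [map_mul, map_inv]
    exact mul_mem (inv_mem (hzΓ _)) (hzΓ _)
  have hone : (⟨_, hmem⟩ : Γ) ∈ ({1} : Set Γ) := by
    rw [← hUΓ]
    exact hn
  have hsq := sq_eq_one_of_diagPSL_eq_one (congrArg Subtype.val hone)
  have hlt : φ n < φ (n + 1) := hφ n.lt_succ_self
  refine ⟨2 * (φ (n + 1) - φ n), by omega, 2 * (p (φ n) - p (φ (n + 1))), ?_⟩
  obtain ⟨d, hd⟩ := Nat.exists_eq_add_of_lt hlt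
  have hz' : ((z (φ (n + 1)) : ℂˣ) : ℂ) ^ 2 = (z (φ n) : ℂ) ^ 2 := by
    have h0 : (z (φ n) : ℂ) ≠ 0 := (z (φ n)).ne_zero
    rw [Units.val_mul, Units.val_inv_eq_inv_val, mul_pow, inv_pow] at hsq
    field_simp at hsq
    exact hsq
  simp only [hz, Units.val_mul, Units.val_pow_eq_pow_val, Units.val_zpow_eq_zpow_val] at hz'
  have hα0 : (α : ℂ) ≠ 0 := α.ne_zero
  have hβ0 : (β : ℂ) ≠ 0 := β.ne_zero
  rw [hd, add_assoc, pow_add] at hz'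
  rw [hd, show φ n + d + 1 - φ n = d + 1 by omega, mul_comm 2, pow_mul, mul_comm 2,
    _root_.zpow_mul, zpow_sub₀ hα0, zpow_ofNat, div_pow]
  field_simp at hz' ⊢
  linear_combination hz'

lemma CongrMod.add {A : Subring ℂ} {n : ℕ} {y z y' z' : ℂ} (h : CongrMod A n y z)
    (h' : CongrMod A n y' z') : CongrMod A n (y + y') (z + z') := by
  obtain ⟨q, hq, e⟩ := h
  obtain ⟨q', hq', e'⟩ := h'
  exact ⟨q + q', add_mem hq hq', by linear_combination e + e'⟩

lemma CongrMod.conj {A : Subring ℂ} {n : ℕ} {ζ : ℂ} {X W Y Z : SL2C} (hX : X ∈ SL2Over A)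
    (hW : W ∈ SL2Over A) (h : ∀ i j, CongrMod A n (Y i j) (ζ * Z i j)) (i j : Fin 2) :
    CongrMod A n ((X * Y * W) i j) (ζ * (X * Z * W) i j) := by
  have hX' := mem_SL2Over.mp hX
  have hW' := mem_SL2Over.mp hW
  simp only [Matrix.SpecialLinearGroup.coe_mul, Matrix.mul_apply, Fin.sum_univ_two]
  have h1 := fun k l => (h k l).mul_left (mul_mem (hX' i k) (hW' l j))
  convert ((h1 0 0).add (h1 0 1)).add ((h1 1 0).add (h1 1 1)) using 1 <;> ring

lemma mem_SL2Over_of_mk_eq_mk {A : Subring ℂ} {X Y : SL2C}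
    (h : (QuotientGroup.mk X : PSL2C) = QuotientGroup.mk Y) (hX : X ∈ SL2Over A) :
    Y ∈ SL2Over A := by
  obtain ⟨ζ, hζ, h⟩ := PSL2C.mk_eq_mk_iff.mp h
  refine mem_SL2Over.mpr fun i j => ?_
  rw [h]
  refine mul_mem ?_ (mem_SL2Over.mp hX i j)
  rcases hζ with rfl | rfl
  · exact one_mem A
  · exact neg_mem (one_mem A)

lemma ContainedInPSL2.mem_SL2Over {R : Subring ℂ} {Γ : Subgroup PSL2C}
    (hΓR : ContainedInPSL2 R Γ) {X : SL2C} (hX : (QuotientGroup.mk X : PSL2C) ∈ Γ) :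
    X ∈ SL2Over R := by
  obtain ⟨Y, hY⟩ := hΓR ⟨_, hX⟩
  exact mem_SL2Over_of_mk_eq_mk hY ⟨Y, rfl⟩

lemma SL2Over_mono {A B : Subring ℂ} (hAB : A ≤ B) : SL2Over A ≤ SL2Over B := fun _ hX =>
  mem_SL2Over.mpr fun i j => hAB (mem_SL2Over.mp hX i j)

lemma IsFGSubringOfNumberField.le_algebraicNumbers {R : Subring ℂ}
    (hR : IsFGSubringOfNumberField R) : R ≤ algebraicNumbers := by
  obtain ⟨-, k, hk, hRk⟩ := hR
  intro z hz
  have h1 : IsAlgebraic ℚ (⟨z, hRk hz⟩ : k) := Algebra.IsAlgebraic.isAlgebraic _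
  refine mem_algebraicClosure_iff.mpr ?_
  exact h1.algHom k.subtype.toRatAlgHom

lemma IsFGSubringOfNumberField.exists_le_almostIntegers {R : Subring ℂ}
    (hR : IsFGSubringOfNumberField R) {T : Set ℂ} (hT : T.Finite) (hTA : T ⊆ algebraicNumbers) :
    ∃ N : ℕ, N ≠ 0 ∧ R ≤ almostIntegers N ∧ T ⊆ almostIntegers N := by
  classical
  have hRA := hR.le_algebraicNumbers
  obtain ⟨⟨s, rfl⟩, -⟩ := hR
  obtain ⟨N, hN, h⟩ := almostIntegers.exists_forall_mem (s ∪ hT.toFinset) fun z hz => by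
    rcases Finset.mem_union.mp hz with hz | hz
    · exact mem_algebraicClosure_iff.mp (hRA (Subring.subset_closure hz))
    · exact mem_algebraicClosure_iff.mp (hTA (hT.mem_toFinset.mp hz))
  refine ⟨N, hN, Subring.closure_le.mpr fun z hz => h z (Finset.mem_union_left _ hz),
    fun z hz => h z (Finset.mem_union_right _ (hT.mem_toFinset.mpr hz))⟩

/-- The set of entries of a matrix. -/
def entries (X : SL2C) : Set ℂ := Set.range fun p : Fin 2 × Fin 2 => X p.1 p.2

lemma finite_entries (X : SL2C) : (entries X).Finite := Set.finite_range _

lemma entries_subset_iff {A : Subring ℂ} {X : SL2C} : entries X ⊆ A ↔ X ∈ SL2Over A := by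
  rw [mem_SL2Over]
  exact ⟨fun h i j => h ⟨(i, j), rfl⟩, fun h => by rintro _ ⟨p, rfl⟩; exact h _ _⟩

lemma inv_entries_subset_algebraicNumbers {X : SL2C} (hX : X ∈ SL2Over algebraicNumbers) :
    (entries X)⁻¹ ⊆ algebraicNumbers := by
  intro z hz
  obtain ⟨p, hp⟩ := hz
  rw [← inv_inv z, ← hp]
  exact (algebraicClosure ℚ ℂ).inv_mem (mem_SL2Over.mp hX _ _)

lemma isUnitIn_of_conj_diagSL_mem {A : Subring ℂ} {C : SL2C} {α : ℂˣ} (hC : C ∈ SL2Over A)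
    (h : C * diagSL α * C⁻¹ ∈ SL2Over A) : IsUnitIn A α := by
  have h1 := mul_mem (mul_mem (inv_mem hC) h) hC
  rw [show C⁻¹ * (C * diagSL α * C⁻¹) * C = diagSL α by group] at h1
  exact ⟨α.ne_zero, mem_SL2Over.mp h1 0 0, mem_SL2Over.mp h1 1 1⟩

lemma IsFGSubringOfNumberField.exists_level {R : Subring ℂ} (hR : IsFGSubringOfNumberField R)
    {C E G : SL2C} (hC : C ∈ SL2Over algebraicNumbers) (hE : E ∈ SL2Over algebraicNumbers)
    (hG : G ∈ SL2Over R) {T : Set ℂ} (hT : T.Finite) (hTA : T ⊆ algebraicNumbers) :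
    ∃ N : ℕ, N ≠ 0 ∧ R ≤ almostIntegers N ∧ C ∈ SL2Over (almostIntegers N) ∧
      E ∈ SL2Over (almostIntegers N) ∧ C⁻¹ * G * E ∈ SL2Over (almostIntegers N) ∧
      (∀ i j, ((C⁻¹ * G * E) i j)⁻¹ ∈ almostIntegers N) ∧ T ⊆ almostIntegers N := by
  have hMA : C⁻¹ * G * E ∈ SL2Over algebraicNumbers :=
    mul_mem (mul_mem (inv_mem hC) (SL2Over_mono hR.le_algebraicNumbers hG)) hE
  obtain ⟨N, hN, hRN, hS⟩ := hR.exists_le_almostIntegers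
    ((((finite_entries C).union (finite_entries E)).union (finite_entries (C⁻¹ * G * E)).inv).union
      hT)
    (Set.union_subset (Set.union_subset (Set.union_subset (entries_subset_iff.mpr hC)
      (entries_subset_iff.mpr hE)) (inv_entries_subset_algebraicNumbers hMA)) hTA)
  rw [Set.union_subset_iff, Set.union_subset_iff, Set.union_subset_iff, entries_subset_iff,
    entries_subset_iff] at hS
  obtain ⟨⟨⟨hCN, hEN⟩, hM₁⟩, hTN⟩ := hS
  exact ⟨N, hN, hRN, hCN, hEN, mul_mem (mul_mem (inv_mem hCN) (SL2Over_mono hRN hG)) hEN,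
    fun i j => hM₁ (Set.inv_mem_inv.mpr ⟨(i, j), rfl⟩), hTN⟩

lemma diagSL_mul_mul_diagSL_apply (u w : ℂˣ) (M : SL2C) (i j : Fin 2) :
    (diagSL u * M * diagSL w) i j =
      ![(u : ℂ), (u : ℂ)⁻¹] i * ![(w : ℂ), (w : ℂ)⁻¹] j * M i j := by
  rw [Matrix.SpecialLinearGroup.coe_mul, Matrix.SpecialLinearGroup.coe_mul, coe_diagSL, coe_diagSL]
  fin_cases i <;> fin_cases j <;> simp [Matrix.mul_apply, Matrix.vecMul, dotProduct, Fin.sum_univ_two] <;>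
    ring

lemma IsLoxodromic.exists_eq_diagPSL {R : Subring ℂ} (hR : IsFGSubringOfNumberField R)
    {Γ : Subgroup PSL2C} (hΓR : ContainedInPSL2 R Γ) {h : Γ} (hh : IsLoxodromic (h : PSL2C)) :
    ∃ C ∈ SL2Over algebraicNumbers, ∃ α : ℂˣ, ‖(α : ℂ)‖ ≠ 1 ∧ diagPSL C α = h := by
  obtain ⟨G, hG, htr⟩ := hh
  obtain ⟨C, hC, α, hα, rfl⟩ := exists_eq_conj_diagSL
    (SL2Over_mono hR.le_algebraicNumbers (hΓR.mem_SL2Over (by rw [hG]; exact h.2))) htr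
  exact ⟨C, hC, α, hα, hG⟩

/-- The element `γ` is congruent to elements of `X` modulo every positive integer. -/
def IsCongrLimit (R : Subring ℂ) {Γ : Subgroup PSL2C} (X : Set Γ) (γ : Γ) : Prop :=
  ∀ n : ℕ, n ≠ 0 → ∃ x ∈ X, ∀ Y Z : SL2C, (QuotientGroup.mk Y : PSL2C) = γ →
    (QuotientGroup.mk Z : PSL2C) = x →
      ∃ ζ ∈ R, CongrMod R n (ζ ^ 2) 1 ∧ ∀ i j, CongrMod R n (Y i j) (ζ * Z i j)

lemma congruenceClosed_of_forall_isCongrLimit {R : Subring ℂ} {Γ : Subgroup PSL2C}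
    (hΓR : ContainedInPSL2 R Γ) {X : Set Γ} (h : ∀ γ, IsCongrLimit R X γ → γ ∈ X) :
    CongruenceClosed R Γ X := fun γ hγ => by
  by_contra hcon
  exact hγ (h γ (exists_congrMod_of_not_congruenceClosed hΓR hcon))

lemma CongruenceClosed.of_inv {R : Subring ℂ} {Γ : Subgroup PSL2C} {X : Set Γ}
    (h : CongruenceClosed R Γ X⁻¹) : CongruenceClosed R Γ X := fun γ hγ => by
  obtain ⟨I, hI, η, hη, hn⟩ := h γ⁻¹ (by simpa using hγ)
  refine ⟨I, hI, η, hη, ?_⟩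
  rintro ⟨x, hx, hxγ⟩
  exact hn ⟨x⁻¹, by simpa using hx, by rw [map_inv, map_inv, hxγ]⟩

lemma mk_eq_of_conj_eq {C E Y V : SL2C} {ζ : ℂ} (hζ : ζ = 1 ∨ ζ = -1)
    (h : ∀ i j, (C⁻¹ * Y * E) i j = ζ * V i j) :
    (QuotientGroup.mk Y : PSL2C) = QuotientGroup.mk (C * V * E⁻¹) := by
  have h1 : (QuotientGroup.mk (C⁻¹ * Y * E) : PSL2C) = QuotientGroup.mk V :=
    (PSL2C.mk_eq_mk_iff.mpr ⟨ζ, hζ, h⟩).symm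
  have h2 : Y = C * (C⁻¹ * Y * E) * E⁻¹ := by group
  rw [h2]
  exact congrArg (fun x : PSL2C => QuotientGroup.mk C * x * QuotientGroup.mk E⁻¹) h1

lemma mk_conj_diagSL_mul_mul (C G W : SL2C) (α : ℂˣ) (m : ℤ) :
    (QuotientGroup.mk (C * diagSL (α ^ m) * C⁻¹ * G * W) : PSL2C) =
      diagPSL C α ^ m * QuotientGroup.mk G * QuotientGroup.mk W := by
  rw [← map_zpow]
  rfl

lemma SL2C_apply_zero_zero_ne_zero_or (M : SL2C) : M 0 0 ≠ 0 ∨ M 1 0 ≠ 0 := by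
  by_contra! h
  have := M.det_coe
  rw [Matrix.det_fin_two, h.1, h.2] at this
  simp at this

lemma diagSL_mul_eq_mul_diagSL {M : SL2C} (α : ℂˣ) (h01 : M 0 1 = 0) (h10 : M 1 0 = 0) :
    diagSL α * M = M * diagSL α := by
  ext i j
  rw [Matrix.SpecialLinearGroup.coe_mul, Matrix.SpecialLinearGroup.coe_mul, coe_diagSL]
  fin_cases i <;> fin_cases j <;>
    simp [Matrix.mul_apply, Fin.sum_univ_two, h01, h10, mul_comm]

lemma diagSL_mul_eq_mul_diagSL_inv {M : SL2C} (α : ℂˣ) (h00 : M 0 0 = 0) (h11 : M 1 1 = 0) :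
    diagSL α * M = M * diagSL α⁻¹ := by
  ext i j
  rw [Matrix.SpecialLinearGroup.coe_mul, Matrix.SpecialLinearGroup.coe_mul, coe_diagSL, coe_diagSL]
  fin_cases i <;> fin_cases j <;>
    simp [Matrix.mul_apply, Fin.sum_univ_two, h00, h11, mul_comm]

lemma diagPSL_conj {C E G : SL2C} {α β : ℂˣ}
    (h : diagSL α * (C⁻¹ * G * E) = C⁻¹ * G * E * diagSL β) :
    (QuotientGroup.mk G : PSL2C)⁻¹ * diagPSL C α * QuotientGroup.mk G = diagPSL E β := by
  have h1 : diagSL β = (C⁻¹ * G * E)⁻¹ * (diagSL α * (C⁻¹ * G * E)) := by rw [h]; group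
  rw [diagPSL_apply, diagPSL_apply, h1, ← QuotientGroup.mk_inv, ← QuotientGroup.mk_mul,
    ← QuotientGroup.mk_mul]
  congr 1
  group

/-- Double cosets of loxodromic subgroups contain all their congruence limits. -/
theorem mem_of_isCongrLimit_loxodromic {R : Subring ℂ} (hR : IsFGSubringOfNumberField R)
    {Γ : Subgroup PSL2C} (hΓ : DiscreteTopology Γ) (hΓR : ContainedInPSL2 R Γ) {h g k γ : Γ}
    (hh : IsLoxodromic (h : PSL2C)) (hk : IsLoxodromic (k : PSL2C))
    (hγ : IsCongrLimit R {x | ∃ a ∈ Subgroup.zpowers h, ∃ b ∈ Subgroup.zpowers k, x = a * g * b} γ) :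
    ∃ a ∈ Subgroup.zpowers h, ∃ b ∈ Subgroup.zpowers k, γ = a * g * b := by
  obtain ⟨C, hC, α, hα1, hα⟩ := hh.exists_eq_diagPSL hR hΓR
  obtain ⟨E, hE, β, hβ1, hβ⟩ := hk.exists_eq_diagPSL hR hΓR
  obtain ⟨G, hG⟩ := QuotientGroup.mk_surjective (g : PSL2C)
  obtain ⟨Y, hY⟩ := QuotientGroup.mk_surjective (γ : PSL2C)
  have hGR : G ∈ SL2Over R := hΓR.mem_SL2Over (by rw [hG]; exact g.2)
  have hYR : Y ∈ SL2Over R := hΓR.mem_SL2Over (by rw [hY]; exact γ.2)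
  have hαR : C * diagSL α * C⁻¹ ∈ SL2Over R :=
    hΓR.mem_SL2Over (by rw [← diagPSL_apply, hα]; exact h.2)
  have hβR : E * diagSL β * E⁻¹ ∈ SL2Over R :=
    hΓR.mem_SL2Over (by rw [← diagPSL_apply, hβ]; exact k.2)
  obtain ⟨N, hN, hRN, hCN, hEN, hM, hM₁, -⟩ := hR.exists_level hC hE hGR Set.finite_empty
    (Set.empty_subset _)
  have hRN' := SL2Over_mono hRN
  have hM' : C⁻¹ * Y * E ∈ SL2Over (almostIntegers N) :=
    mul_mem (mul_mem (inv_mem hCN) (hRN' hYR)) hEN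
  have hαN : IsUnitIn (almostIntegers N) α := isUnitIn_of_conj_diagSL_mem hCN (hRN' hαR)
  have hβN : IsUnitIn (almostIntegers N) β := isUnitIn_of_conj_diagSL_mem hEN (hRN' hβR)
  have htw : TwistCongr (almostIntegers N) α β (C⁻¹ * G * E : SL2C) (C⁻¹ * Y * E : SL2C) := by
    intro n hn
    obtain ⟨-, ⟨-, ⟨m, rfl⟩, -, ⟨l, rfl⟩, rfl⟩, hx⟩ := hγ n hn
    obtain ⟨ζ, hζ, hζ1, hx⟩ := hx Y (C * diagSL (α ^ m) * C⁻¹ * G * (E * diagSL (β ^ l) * E⁻¹)) hY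
      (by rw [mk_conj_diagSL_mul_mul, ← diagPSL_apply, map_zpow, hα, hβ, hG]; rfl)
    refine ⟨ζ, hRN hζ, hζ1.mono hRN, m, l, fun i j => ?_⟩
    have := CongrMod.conj (inv_mem hCN) hEN (fun i j => (hx i j).mono hRN) i j
    rwa [show C⁻¹ * (C * diagSL (α ^ m) * C⁻¹ * G * (E * diagSL (β ^ l) * E⁻¹)) * E =
      diagSL (α ^ m) * (C⁻¹ * G * E) * diagSL (β ^ l) by group, diagSL_mul_mul_diagSL_apply,
      Units.val_zpow_eq_zpow_val, Units.val_zpow_eq_zpow_val] at this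
  have hβΓ : diagPSL E β ∈ Γ := by rw [hβ]; exact k.2
  have hconj : (QuotientGroup.mk G : PSL2C)⁻¹ * diagPSL C α * QuotientGroup.mk G ∈ Γ := by
    rw [hα, hG]
    exact (g⁻¹ * h * g).2
  obtain ⟨ζ, hζ, m, l, hml⟩ := htw.exists_isTwist hN hαN hα1 hβN hβ1 (mem_SL2Over.mp hM)
    hM₁ (mem_SL2Over.mp hM')
    (SL2C_apply_zero_zero_ne_zero_or _)
    (fun h01 h10 => by
      rw [diagPSL_conj (diagSL_mul_eq_mul_diagSL α h01 h10)] at hconj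
      exact exists_pow_eq_zpow_of_mem_discrete hΓ hα1 hconj hβΓ)
    (fun h00 h11 => by
      rw [diagPSL_conj (diagSL_mul_eq_mul_diagSL_inv α h00 h11), map_inv, inv_mem_iff] at hconj
      exact exists_pow_eq_zpow_of_mem_discrete hΓ hα1 hconj hβΓ)
  refine ⟨h ^ m, ⟨m, rfl⟩, k ^ l, ⟨l, rfl⟩, Subtype.ext ?_⟩
  have := mk_eq_of_conj_eq (C := C) (E := E) (Y := Y)
    (V := diagSL (α ^ m) * (C⁻¹ * G * E) * diagSL (β ^ l)) hζ fun i j => by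
      rw [diagSL_mul_mul_diagSL_apply, Units.val_zpow_eq_zpow_val, Units.val_zpow_eq_zpow_val]
      exact hml i j
  rw [← hY, this, show C * (diagSL (α ^ m) * (C⁻¹ * G * E) * diagSL (β ^ l)) * E⁻¹ =
    C * diagSL (α ^ m) * C⁻¹ * G * (E * diagSL (β ^ l) * E⁻¹) by group,
    mk_conj_diagSL_mul_mul, ← diagPSL_apply, map_zpow, hα, hβ, hG]
  rfl

/-- The one-parameter group of classes of matrices conjugate to unitriangular ones by `E`. -/
noncomputable def unipPSL (E : SL2C) : Multiplicative ℂ →* PSL2C :=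
  (QuotientGroup.mk' _).comp ((MulAut.conj E).toMonoidHom.comp unipSL)

lemma unipPSL_apply (E : SL2C) (v : Multiplicative ℂ) :
    unipPSL E v = (QuotientGroup.mk (E * unipSL v * E⁻¹) : PSL2C) := rfl

lemma isParabolic_unipPSL {E : SL2C} {v : Multiplicative ℂ} (h : unipPSL E v ≠ 1) :
    IsParabolic (unipPSL E v) := by
  refine ⟨h, _, (unipPSL_apply E v).symm, Or.inl ?_⟩
  have := trace_conj (unipSL v) E⁻¹
  rw [inv_inv] at this
  rw [this, coe_unipSL, trace_fin_two]
  norm_num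

lemma IsParabolic.exists_trace_eq_two {x : PSL2C} (hx : IsParabolic x) :
    ∃ X : SL2C, (QuotientGroup.mk X : PSL2C) = x ∧
      Matrix.trace (X : Matrix (Fin 2) (Fin 2) ℂ) = 2 := by
  obtain ⟨-, X, rfl, h | h⟩ := hx
  · exact ⟨X, rfl, h⟩
  · refine ⟨-X, PSL2C.mk_eq_mk_iff.mpr ⟨-1, Or.inr rfl, fun i j => by simp⟩, ?_⟩
    rw [Matrix.SpecialLinearGroup.coe_neg, Matrix.trace_neg, h, neg_neg]

lemma exists_eq_unipSL_of_commute {B : SL2C} {t : Multiplicative ℂ} (ht : t.toAdd ≠ 0)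
    (htr : Matrix.trace (B : Matrix (Fin 2) (Fin 2) ℂ) = 2)
    (h : (QuotientGroup.mk (unipSL t * B) : PSL2C) = QuotientGroup.mk (B * unipSL t)) :
    ∃ v, B = unipSL v := by
  obtain ⟨ζ, hζ, h⟩ := PSL2C.mk_eq_mk_iff.mp h
  have hdet := B.det_coe
  rw [Matrix.det_fin_two] at hdet
  rw [trace_fin_two] at htr
  have h00 := h 0 0
  have h10 := h 1 0
  rw [Matrix.SpecialLinearGroup.coe_mul, Matrix.SpecialLinearGroup.coe_mul, coe_unipSL] at h00 h10
  simp [Matrix.mul_apply, Fin.sum_univ_two] at h00 h10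
  have hc : B 1 0 = 0 := by
    rcases hζ with rfl | rfl
    · have : t.toAdd * B 1 0 = 0 := by linear_combination -h00
      exact (mul_eq_zero.mp this).resolve_left ht
    · have : (2 : ℂ) * B 1 0 = 0 := by grind
      simpa using this
  rw [hc, mul_zero, sub_zero] at hdet
  have ha : B 0 0 = 1 := by
    have : (B 0 0 - 1) ^ 2 = 0 := by linear_combination B 0 0 * htr - hdet
    linear_combination pow_eq_zero_iff two_ne_zero |>.mp this
  refine ⟨.ofAdd (B 0 1), ?_⟩
  ext i j
  fin_cases i <;> fin_cases j
  · exact ha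
  · rfl
  · exact hc
  · show B 1 1 = 1
    linear_combination htr - ha

/-- An abelian group of parabolic elements fixes a common point. -/
lemma exists_forall_mem_range_unipPSL {R : Subring ℂ} (hR : IsFGSubringOfNumberField R)
    {Γ : Subgroup PSL2C} (hΓR : ContainedInPSL2 R Γ) {K : Subgroup Γ}
    (hK : ∀ a ∈ K, ∀ b ∈ K, a * b = b * a) (hKP : ∀ x ∈ K, x ≠ 1 → IsParabolic (x : PSL2C)) :
    ∃ E ∈ SL2Over algebraicNumbers, ∀ x ∈ K, (x : PSL2C) ∈ (unipPSL E).range := by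
  by_cases hbot : ∀ x ∈ K, x = 1
  · exact ⟨1, one_mem _, fun x hx => by rw [hbot x hx]; exact one_mem _⟩
  push Not at hbot
  obtain ⟨p, hp, hp1⟩ := hbot
  obtain ⟨X, hX, htr⟩ := (hKP p hp hp1).exists_trace_eq_two
  obtain ⟨E, hE, t, rfl⟩ := exists_eq_conj_unipSL
    (SL2Over_mono hR.le_algebraicNumbers (hΓR.mem_SL2Over (by rw [hX]; exact p.2))) htr
  have ht : t.toAdd ≠ 0 := fun ht => by
    obtain rfl : t = 1 := ht
    rw [← unipPSL_apply, map_one] at hX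
    exact hp1 (Subtype.ext hX.symm)
  refine ⟨E, hE, fun x hx => ?_⟩
  by_cases hx1 : x = 1
  · rw [hx1]
    exact one_mem _
  obtain ⟨B, hB, hBtr⟩ := (hKP x hx hx1).exists_trace_eq_two
  have hcomm : (QuotientGroup.mk (E * unipSL t * E⁻¹) : PSL2C) * QuotientGroup.mk B =
      QuotientGroup.mk B * QuotientGroup.mk (E * unipSL t * E⁻¹) := by
    rw [hX, hB]
    exact congrArg Subtype.val (hK p hp x hx)
  obtain ⟨v, hv⟩ := exists_eq_unipSL_of_commute (B := E⁻¹ * B * E) ht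
    (by rw [trace_conj, hBtr]) <| by
    have h1 : unipSL t * (E⁻¹ * B * E) = E⁻¹ * (E * unipSL t * E⁻¹ * B) * E := by group
    have h2 : E⁻¹ * B * E * unipSL t = E⁻¹ * (B * (E * unipSL t * E⁻¹)) * E := by group
    rw [h1, h2]
    exact congrArg (fun x : PSL2C => QuotientGroup.mk E⁻¹ * x * QuotientGroup.mk E) hcomm
  refine ⟨v, ?_⟩
  rw [unipPSL_apply, ← hv, ← hB]
  congr 1
  group

lemma exists_unipSL_of_column {Q M : SL2C} {ζ : ℂ} (hζ : ζ = 1 ∨ ζ = -1)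
    (h : ∀ i, M i 0 = ζ * Q i 0) : ∃ v, ∀ i j, M i j = ζ * (Q * unipSL v) i j := by
  have hζ2 := sq_eq_one_iff.mpr hζ
  have hQ := Q.det_coe
  have hM := M.det_coe
  rw [Matrix.det_fin_two] at hQ hM
  have h0 := h 0
  have h1 := h 1
  refine ⟨.ofAdd (ζ * (Q 1 1 * M 0 1 - Q 0 1 * M 1 1)), fun i j => ?_⟩
  rw [Matrix.SpecialLinearGroup.coe_mul, coe_unipSL]
  fin_cases i <;> fin_cases j <;> simp [Matrix.mul_apply, Fin.sum_univ_two]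
  · exact h0
  · grind
  · exact h1
  · grind

lemma mul_unipSL_apply (Q : SL2C) (v : Multiplicative ℂ) (i : Fin 2) :
    (Q * unipSL v) i 0 = Q i 0 ∧ (Q * unipSL v) i 1 = Q i 0 * v.toAdd + Q i 1 := by
  rw [Matrix.SpecialLinearGroup.coe_mul, coe_unipSL]
  simp [Matrix.mul_apply, Fin.sum_univ_two]

lemma diagSL_mul_apply (u : ℂˣ) (M : SL2C) (i j : Fin 2) :
    (diagSL u * M) i j = ![(u : ℂ), (u : ℂ)⁻¹] i * M i j := by
  rw [Matrix.SpecialLinearGroup.coe_mul, coe_diagSL]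
  fin_cases i <;> simp [Matrix.mul_apply, Fin.sum_univ_two]

/-- A congruence limit of `⟨h⟩gK`, with `K` unipotent, lies in `⟨h⟩gu` for some unipotent `u` with
the same fixed point as `K`. -/
lemma exists_eq_mul_unipPSL_of_isCongrLimit {R : Subring ℂ} (hR : IsFGSubringOfNumberField R)
    {Γ : Subgroup PSL2C} (hΓR : ContainedInPSL2 R Γ) {h g γ : Γ} {K : Subgroup Γ}
    (hh : IsLoxodromic (h : PSL2C)) {E : SL2C} (hE : E ∈ SL2Over algebraicNumbers)
    (hKE : ∀ x ∈ K, (x : PSL2C) ∈ (unipPSL E).range)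
    (hγ : IsCongrLimit R {x | ∃ a ∈ Subgroup.zpowers h, ∃ b ∈ K, x = a * g * b} γ) :
    ∃ (m : ℤ) (u : Γ), (u : PSL2C) ∈ (unipPSL E).range ∧ γ = h ^ m * g * u := by
  obtain ⟨C, hC, α, hα1, hα⟩ := hh.exists_eq_diagPSL hR hΓR
  obtain ⟨G, hG⟩ := QuotientGroup.mk_surjective (g : PSL2C)
  obtain ⟨Y, hY⟩ := QuotientGroup.mk_surjective (γ : PSL2C)
  have hGR : G ∈ SL2Over R := hΓR.mem_SL2Over (by rw [hG]; exact g.2)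
  have hYR : Y ∈ SL2Over R := hΓR.mem_SL2Over (by rw [hY]; exact γ.2)
  have hαR : C * diagSL α * C⁻¹ ∈ SL2Over R :=
    hΓR.mem_SL2Over (by rw [← diagPSL_apply, hα]; exact h.2)
  obtain ⟨N, hN, hRN, hCN, hEN, hM, hM₁, -⟩ := hR.exists_level hC hE hGR Set.finite_empty
    (Set.empty_subset _)
  have hRN' := SL2Over_mono hRN
  have hM' : C⁻¹ * Y * E ∈ SL2Over (almostIntegers N) :=
    mul_mem (mul_mem (inv_mem hCN) (hRN' hYR)) hEN
  have hαN : IsUnitIn (almostIntegers N) α := isUnitIn_of_conj_diagSL_mem hCN (hRN' hαR)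
  obtain ⟨M, hMdef⟩ : ∃ M, M = C⁻¹ * G * E := ⟨_, rfl⟩
  obtain ⟨M', hMdef'⟩ : ∃ M', M' = C⁻¹ * Y * E := ⟨_, rfl⟩
  rw [← hMdef] at hM hM₁
  rw [← hMdef'] at hM'
  rw [mem_SL2Over] at hM hM'
  have htw : TwistCongr (almostIntegers N) α 1 !![M 0 0, 0; M 1 0, 0] !![M' 0 0, 0; M' 1 0, 0] := by
    intro n hn
    obtain ⟨-, ⟨-, ⟨m, rfl⟩, k, hk, rfl⟩, hx⟩ := hγ n hn
    obtain ⟨v, hv⟩ := hKE k hk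
    obtain ⟨ζ, hζ, hζ1, hx⟩ := hx Y (C * diagSL (α ^ m) * C⁻¹ * G * (E * unipSL v * E⁻¹)) hY
      (by rw [mk_conj_diagSL_mul_mul, ← unipPSL_apply, hv, hα, hG]; rfl)
    refine ⟨ζ, hRN hζ, hζ1.mono hRN, m, 0, fun i j => ?_⟩
    have := CongrMod.conj (inv_mem hCN) hEN (fun i j => (hx i j).mono hRN) i 0
    rw [show C⁻¹ * (C * diagSL (α ^ m) * C⁻¹ * G * (E * unipSL v * E⁻¹)) * E =
      diagSL (α ^ m) * (C⁻¹ * G * E) * unipSL v by group, (mul_unipSL_apply _ _ _).1,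
      diagSL_mul_apply, Units.val_zpow_eq_zpow_val, ← hMdef, ← hMdef'] at this
    fin_cases j
    · fin_cases i <;> simpa using this
    · exact ⟨0, zero_mem _, by fin_cases i <;> simp⟩
  obtain ⟨ζ, hζ, m, l, hml⟩ := htw.exists_isTwist_column hN hαN hα1
    (fun i j => by fin_cases i <;> fin_cases j <;> simp [hM])
    (fun i j => by fin_cases i <;> fin_cases j <;> simp [hM₁])
    (fun i j => by fin_cases i <;> fin_cases j <;> simp [hM'])
    (SL2C_apply_zero_zero_ne_zero_or M) rfl rfl
  obtain ⟨v, hv⟩ := exists_unipSL_of_column (Q := diagSL (α ^ m) * M) (M := M') hζ fun i => by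
    rw [diagSL_mul_apply, Units.val_zpow_eq_zpow_val]
    have := hml i 0
    fin_cases i <;> simpa using this
  have hYv : (γ : PSL2C) = ↑(h ^ m * g) * unipPSL E v := by
    rw [hMdef, hMdef'] at hv
    have := mk_eq_of_conj_eq hζ hv
    rw [← hY, this, show C * (diagSL (α ^ m) * (C⁻¹ * G * E) * unipSL v) * E⁻¹ =
      C * diagSL (α ^ m) * C⁻¹ * G * (E * unipSL v * E⁻¹) by group,
      mk_conj_diagSL_mul_mul, ← unipPSL_apply, hα, hG]
    rfl
  refine ⟨m, (h ^ m * g)⁻¹ * γ, ⟨v, ?_⟩, by group⟩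
  rw [Subgroup.coe_mul, hYv, Subgroup.coe_inv, inv_mul_cancel_left]

/-- Double cosets of a loxodromic and a maximal parabolic subgroup contain all their congruence
limits. -/
theorem mem_of_isCongrLimit_maxParabolic {R : Subring ℂ} (hR : IsFGSubringOfNumberField R)
    {Γ : Subgroup PSL2C} (hΓR : ContainedInPSL2 R Γ) {h g γ : Γ} {K : Subgroup Γ}
    (hh : IsLoxodromic (h : PSL2C)) (hK : ∀ a ∈ K, ∀ b ∈ K, a * b = b * a)
    (hKP : IsMaxParabolicSubgroup Γ K)
    (hγ : IsCongrLimit R {x | ∃ a ∈ Subgroup.zpowers h, ∃ b ∈ K, x = a * g * b} γ) :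
    ∃ a ∈ Subgroup.zpowers h, ∃ b ∈ K, γ = a * g * b := by
  obtain ⟨E, hE, hKE⟩ := exists_forall_mem_range_unipPSL hR hΓR hK hKP.1
  obtain ⟨m, u, hu, rfl⟩ := exists_eq_mul_unipPSL_of_isCongrLimit hR hΓR hh hE hKE hγ
  have hP := hKP.2 ((unipPSL E).range.subgroupOf Γ) (fun x hx hx1 => by
    obtain ⟨v, hv⟩ := Subgroup.mem_subgroupOf.mp hx
    rw [← hv]
    refine isParabolic_unipPSL fun hv1 => hx1 (Subtype.ext ?_)
    rw [← hv, hv1]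
    rfl) fun x hx => Subgroup.mem_subgroupOf.mpr (hKE x hx)
  exact ⟨h ^ m, ⟨m, rfl⟩, u, hP ▸ Subgroup.mem_subgroupOf.mpr hu, rfl⟩

lemma exists_rat_eq_div_of_isCongrLimit {R : Subring ℂ} (hR : IsFGSubringOfNumberField R)
    {Γ : Subgroup PSL2C} (hΓR : ContainedInPSL2 R Γ) {h g p u : Γ}
    (hh : IsLoxodromic (h : PSL2C)) {E : SL2C} (hE : E ∈ SL2Over algebraicNumbers)
    {t v : Multiplicative ℂ} (ht : t.toAdd ≠ 0) (hp : unipPSL E t = p) (hu : unipPSL E v = u) {m₀ : ℤ}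
    (hγ : IsCongrLimit R {x | ∃ a ∈ Subgroup.zpowers h, ∃ b ∈ Subgroup.zpowers p, x = a * g * b}
      (h ^ m₀ * g * u)) :
    ∃ r : ℚ, v.toAdd / t.toAdd = (r : ℂ) := by
  obtain ⟨C, hC, α, hα1, hα⟩ := hh.exists_eq_diagPSL hR hΓR
  obtain ⟨G, hG⟩ := QuotientGroup.mk_surjective (g : PSL2C)
  have hGR : G ∈ SL2Over R := hΓR.mem_SL2Over (by rw [hG]; exact g.2)
  have hαR : C * diagSL α * C⁻¹ ∈ SL2Over R :=
    hΓR.mem_SL2Over (by rw [← diagPSL_apply, hα]; exact h.2)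
  have halg : ∀ (w : Multiplicative ℂ) (x : Γ), unipPSL E w = x → w.toAdd ∈ algebraicNumbers :=
    fun w x hw => by
      have h1 : E * unipSL w * E⁻¹ ∈ SL2Over R :=
        hΓR.mem_SL2Over (by rw [← unipPSL_apply, hw]; exact x.2)
      have h2 := mul_mem (mul_mem (inv_mem hE) (SL2Over_mono hR.le_algebraicNumbers h1)) hE
      rw [show E⁻¹ * (E * unipSL w * E⁻¹) * E = unipSL w by group] at h2
      exact mem_SL2Over.mp h2 0 1
  have htA := halg t p hp
  have hvA := halg v u hu
  obtain ⟨N, hN, hRN, hCN, hEN, hM, hM₁, hT⟩ := hR.exists_level hC hE hGR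
    (T := {t.toAdd, (t.toAdd)⁻¹, v.toAdd / t.toAdd}) (Set.toFinite _) (by
      rintro z (rfl | rfl | rfl)
      · exact htA
      · exact (algebraicClosure ℚ ℂ).inv_mem htA
      · exact algebraicNumbers.div_mem hvA htA)
  simp only [Set.insert_subset_iff, Set.singleton_subset_iff, SetLike.mem_coe] at hT
  obtain ⟨htN, htN', hvtN⟩ := hT
  have hαN : IsUnitIn (almostIntegers N) α :=
    isUnitIn_of_conj_diagSL_mem hCN (SL2Over_mono hRN hαR)
  obtain ⟨M, hMdef⟩ : ∃ M, M = C⁻¹ * G * E := ⟨_, rfl⟩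
  rw [← hMdef] at hM hM₁
  rw [mem_SL2Over] at hM
  obtain ⟨i, hi⟩ : ∃ i, M i 0 ≠ 0 := by
    rcases SL2C_apply_zero_zero_ne_zero_or M with h0 | h0
    exacts [⟨0, h0⟩, ⟨1, h0⟩]
  refine almostIntegers.exists_rat_eq_of_forall_congrMod hN hvtN fun n hn => ?_
  obtain ⟨-, ⟨-, ⟨m, rfl⟩, -, ⟨l, rfl⟩, rfl⟩, hx⟩ := hγ n hn
  obtain ⟨ζ, hζ, -, hx⟩ := hx (C * diagSL (α ^ m₀) * C⁻¹ * G * (E * unipSL v * E⁻¹))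
    (C * diagSL (α ^ m) * C⁻¹ * G * (E * unipSL (t ^ l) * E⁻¹))
    (by rw [mk_conj_diagSL_mul_mul, ← unipPSL_apply, hu, hα, hG]; rfl)
    (by rw [mk_conj_diagSL_mul_mul, ← unipPSL_apply, map_zpow, hp, hα, hG]; rfl)
  have hconj := CongrMod.conj (inv_mem hCN) hEN (fun i j => (hx i j).mono hRN)
  rw [show C⁻¹ * (C * diagSL (α ^ m) * C⁻¹ * G * (E * unipSL (t ^ l) * E⁻¹)) * E =
    diagSL (α ^ m) * (C⁻¹ * G * E) * unipSL (t ^ l) by group,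
    show C⁻¹ * (C * diagSL (α ^ m₀) * C⁻¹ * G * (E * unipSL v * E⁻¹)) * E =
    diagSL (α ^ m₀) * (C⁻¹ * G * E) * unipSL v by group, ← hMdef] at hconj
  have h0 := hconj i 0
  have h1 := hconj i 1
  rw [(mul_unipSL_apply _ _ _).1, (mul_unipSL_apply _ _ _).1, diagSL_mul_apply,
    diagSL_mul_apply] at h0
  rw [(mul_unipSL_apply _ _ _).2, (mul_unipSL_apply _ _ _).2, diagSL_mul_apply, diagSL_mul_apply,
    diagSL_mul_apply, diagSL_mul_apply, show (t ^ l).toAdd = l * t.toAdd from by simp] at h1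
  have he := (hαN.zpow m₀).diag i
  rw [← Units.val_zpow_eq_zpow_val] at he
  obtain ⟨q, hq, e0⟩ := h0
  obtain ⟨q', hq', e1⟩ := h1
  have ha' := hM₁ i 0
  set e := ![((α ^ m₀ : ℂˣ) : ℂ), ((α ^ m₀ : ℂˣ) : ℂ)⁻¹] i
  set s := ![((α ^ m : ℂˣ) : ℂ), ((α ^ m : ℂˣ) : ℂ)⁻¹] i
  have hlN : (l : ℂ) ∈ almostIntegers N := intCast_mem _ l
  refine ⟨l, e⁻¹ * (M i 0)⁻¹ * (t.toAdd)⁻¹ *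
    (q' - q * (M i 0)⁻¹ * (M i 0 * (l * t.toAdd) + M i 1)), ?_, ?_⟩
  · exact mul_mem (mul_mem (mul_mem he.inv_mem ha') htN') (sub_mem hq' (mul_mem (mul_mem hq ha')
      (add_mem (mul_mem (hM _ _) (mul_mem hlN htN)) (hM _ _))))
  · have he0 := he.ne_zero
    field_simp
    linear_combination (M i 0) * e1 - (M i 0 * (l * t.toAdd) + M i 1) * e0

/-- Double cosets of a loxodromic and a maximal cyclic parabolic subgroup contain all their
congruence limits. -/
theorem mem_of_isCongrLimit_maxCyclicParabolic {R : Subring ℂ} (hR : IsFGSubringOfNumberField R)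
    {Γ : Subgroup PSL2C} (hΓR : ContainedInPSL2 R Γ) {h g γ : Γ} {K : Subgroup Γ}
    (hh : IsLoxodromic (h : PSL2C)) (hh1 : h ≠ 1) (hK : ∀ a ∈ K, ∀ b ∈ K, a * b = b * a)
    (hKP : IsMaxCyclicParabolicSubgroup Γ K)
    (hγ : IsCongrLimit R {x | ∃ a ∈ Subgroup.zpowers h, ∃ b ∈ K, x = a * g * b} γ) :
    ∃ a ∈ Subgroup.zpowers h, ∃ b ∈ K, γ = a * g * b := by
  obtain ⟨E, hE, hKE⟩ := exists_forall_mem_range_unipPSL hR hΓR hK hKP.2.1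
  obtain ⟨m, u, hu, rfl⟩ := exists_eq_mul_unipPSL_of_isCongrLimit hR hΓR hh hE hKE hγ
  refine ⟨h ^ m, ⟨m, rfl⟩, u, ?_, rfl⟩
  obtain ⟨⟨p, rfl⟩, -, hmax⟩ := hKP
  obtain ⟨t, ht⟩ := hKE p (Subgroup.mem_zpowers p)
  obtain ⟨v, hv⟩ := hu
  have ht0 : t.toAdd ≠ 0 := fun h0 => by
    obtain rfl : t = 1 := h0
    obtain rfl : p = 1 := Subtype.ext (by rw [← ht, map_one]; rfl)
    have := hmax _ ⟨h, rfl⟩ (by simp)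
    exact hh1 (by simpa using this)
  obtain ⟨r, hr⟩ := exists_rat_eq_div_of_isCongrLimit hR hΓR hh hE ht0 ht hv hγ
  have hb : (r.den : ℂ) ≠ 0 := by exact_mod_cast r.den_nz
  have hcop := Int.gcd_eq_gcd_ab r.num r.den
  rw [show Int.gcd r.num r.den = 1 from r.reduced] at hcop
  set w : Γ := p ^ Int.gcdB r.num r.den * u ^ Int.gcdA r.num r.den with hw
  have hwv : unipPSL E (.ofAdd (t.toAdd / r.den)) = w := by
    have : (Multiplicative.ofAdd (t.toAdd / r.den) : Multiplicative ℂ) =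
        t ^ Int.gcdB r.num r.den * v ^ Int.gcdA r.num r.den := by
      apply Multiplicative.toAdd.injective
      have hcop' : (1 : ℂ) = r.num * Int.gcdA r.num r.den + r.den * Int.gcdB r.num r.den := by
        exact_mod_cast hcop
      rw [Rat.cast_def, div_eq_iff ht0] at hr
      simp only [toAdd_mul, toAdd_zpow, toAdd_ofAdd, zsmul_eq_mul, hr]
      field_simp
      linear_combination hcop'
    rw [this, map_mul, map_zpow, map_zpow, ht, hv, hw]
    rfl
  have hpow : ∀ (n : ℤ) (x : Γ) (y : Multiplicative ℂ), unipPSL E y = x →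
      n * (t.toAdd / r.den) = y.toAdd → w ^ n = x := fun n x y hy hn => by
    refine Subtype.ext ?_
    rw [← hy, Subgroup.coe_zpow, ← hwv, ← map_zpow]
    congr 1
    apply Multiplicative.toAdd.injective
    rw [← hn]
    simp
  have hK := hmax _ ⟨w, rfl⟩ (Subgroup.zpowers_le.mpr ⟨r.den, hpow _ p t ht (by
    push_cast
    field_simp)⟩)
  rw [← hK]
  refine ⟨r.num, hpow _ u v hv ?_⟩
  rw [Rat.cast_def, div_eq_iff ht0] at hr
  rw [hr]
  ring

/-- Let `Γ ≤ PSL(2, ℂ)` be a discrete subgroup of finite covolume contained in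
`PSL(2, R)`, where `R` is a finitely generated subring of a number field.  Let `H`, `K`
be abelian subgroups of `Γ` and `g ∈ Γ`.  Then the double coset `HgK` is closed in the
congruence topology on `Γ` if (i) `H` and `K` are both loxodromic subgroups, or
(ii) exactly one of `H`, `K` is loxodromic and the other is a maximal parabolic
subgroup, or (iii) exactly one of `H`, `K` is loxodromic and the other is a maximal
cyclic parabolic subgroup.  (The loxodromic subgroups are not required to be
maximal.) -/
theorem double_coset_closed_in_congruence_topology
    (Γ : Subgroup PSL2C) (hdisc : DiscreteTopology ↥Γ) (hvol : HasFiniteCovolume Γ)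
    (R : Subring ℂ) (hR : IsFGSubringOfNumberField R) (hΓR : ContainedInPSL2 R Γ)
    (H K : Subgroup ↥Γ)
    (hH : ∀ a ∈ H, ∀ b ∈ H, a * b = b * a)
    (hK : ∀ a ∈ K, ∀ b ∈ K, a * b = b * a)
    (g : ↥Γ)
    (hcases :
      (IsLoxodromicSubgroup Γ H ∧ IsLoxodromicSubgroup Γ K) ∨
      (IsLoxodromicSubgroup Γ H ∧ IsMaxParabolicSubgroup Γ K) ∨
      (IsMaxParabolicSubgroup Γ H ∧ IsLoxodromicSubgroup Γ K) ∨
      (IsLoxodromicSubgroup Γ H ∧ IsMaxCyclicParabolicSubgroup Γ K) ∨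
      (IsMaxCyclicParabolicSubgroup Γ H ∧ IsLoxodromicSubgroup Γ K)) :
    CongruenceClosed R Γ {x : ↥Γ | ∃ h ∈ H, ∃ k ∈ K, x = h * g * k} := by
  wlog hHlox : IsLoxodromicSubgroup Γ H generalizing H K g
  · have hKlox : IsLoxodromicSubgroup Γ K := by tauto
    have := this K H hK hH g⁻¹ (by tauto) hKlox
    refine CongruenceClosed.of_inv ?_
    convert this using 1
    ext x
    simp only [Set.mem_inv, Set.mem_ofPred_eq]
    constructor
    · rintro ⟨a, ha, b, hb, hx⟩
      exact ⟨b⁻¹, inv_mem hb, a⁻¹, inv_mem ha, by rw [← inv_inv x, hx]; group⟩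
    · rintro ⟨b, hb, a, ha, rfl⟩
      exact ⟨a⁻¹, inv_mem ha, b⁻¹, inv_mem hb, by group⟩
  obtain ⟨h, hh, hfin, rfl⟩ := hHlox
  have hh1 : h ≠ 1 := fun h1 => hfin (h1 ▸ IsOfFinOrder.one)
  refine congruenceClosed_of_forall_isCongrLimit hΓR fun γ hγ => ?_
  have hcases' : IsLoxodromicSubgroup Γ K ∨ IsMaxParabolicSubgroup Γ K ∨
      IsMaxCyclicParabolicSubgroup Γ K := by tauto
  rcases hcases' with ⟨k, hk, -, rfl⟩ | hKP | hKP
  · exact mem_of_isCongrLimit_loxodromic hR hdisc hΓR hh hk hγ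
  · exact mem_of_isCongrLimit_maxParabolic hR hΓR hh hK hKP hγ
  · exact mem_of_isCongrLimit_maxCyclicParabolic hR hΓR hh hh1 hK hKP hγ
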